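/- arXiv:1602.06528 — 6 statements merged into one kernel-verified Lean document; each statement's English description precedes it below -/
import Mathlib

section
/- Let n ≥ 2 and let T be a full-rank sublattice of ℤⁿ with generating matrix A (an invertible n×n real matrix whose columns form a ℤ-basis of T). Let C ⊆ [0,∞)ⁿ be a cone with apex at the origin, set N(s) = card{x ∈ T ∩ C : ‖x‖₁ = s} for s ∈ ℕ, and let α = Vol(A⁻¹(C) ∩ B_{ℓ¹}(0,1)). Assume there is a constant M > 0 such that |Σ_{s=0}^{t} N(s) − α tⁿ| ≤ M t^{n−1} for all integers t ≥ 1. Then lim_{t→∞} F(t)/t^{2n−1} = α · B(n−1, n+1) / ((n−2)! · 2^{n−1}), where F(t) = Σ_{s=0}^{t} Σ_{r=0}^{⌊s/2⌋} C(r+n−2, n−2) · N(s−2r) and B(n−1,n+1) = ∫₀¹ x^{n−2}(1−x)ⁿ dx is the Beta function value. -/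
open MeasureTheory Filter

/-- The integral of a step function over `[0, m]` is the sum of its values. -/
theorem integral_comp_natFloor (h : ℕ → ℝ) (m : ℕ) :
    ∫ u in (0 : ℝ)..m, h ⌊u⌋₊ = ∑ i ∈ Finset.range m, h i := by
  have key : ∀ i : ℕ, Set.EqOn (fun u : ℝ => h ⌊u⌋₊) (fun _ => h i)
      (Set.Ioo (i : ℝ) ((i + 1 : ℕ) : ℝ)) := by
    intro i u hu
    have : ⌊u⌋₊ = i :=
      (Nat.floor_eq_iff (i.cast_nonneg.trans hu.1.le)).2 ⟨hu.1.le, by simpa using hu.2⟩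
    simp [this]
  have hint : ∀ i : ℕ, IntervalIntegrable (fun u : ℝ => h ⌊u⌋₊) volume i ((i + 1 : ℕ) : ℝ) := by
    intro i
    refine IntervalIntegrable.congr_uIoo (f := fun _ => h i) intervalIntegrable_const ?_
    rw [Set.uIoo_of_le (by simp)]
    exact (key i).symm
  have := intervalIntegral.sum_integral_adjacent_intervals (f := fun u : ℝ => h ⌊u⌋₊)
    (μ := volume) (a := fun i : ℕ => (i : ℝ)) (n := m) (fun i _ => hint i)
  rw [Nat.cast_zero] at this
  rw [← this]
  refine Finset.sum_congr rfl fun i _ => ?_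
  rw [intervalIntegral.integral_congr_uIoo (g := fun _ => h i)]
  · simp
  · rw [Set.uIoo_of_le (by simp)]
    exact key i

/-- A sequence asymptotic to `L * (r + 1) ^ k`, sampled along `r` with `r / t → y > 0`, is
asymptotic to `L * y ^ k * t ^ k`. -/
theorem tendsto_comp_div_pow {a : ℕ → ℝ} {k : ℕ} {L y : ℝ}
    (ha : Tendsto (fun r : ℕ => a r / ((r : ℝ) + 1) ^ k) atTop (nhds L)) (hy : 0 < y)
    {r : ℕ → ℕ} (hr : Tendsto (fun t : ℕ => (r t : ℝ) / t) atTop (nhds y)) :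
    Tendsto (fun t : ℕ => a (r t) / (t : ℝ) ^ k) atTop (nhds (L * y ^ k)) := by
  have htop : Tendsto r atTop atTop := by
    have h1 : Tendsto (fun t : ℕ => (r t : ℝ) / t * t) atTop atTop :=
      hr.pos_mul_atTop hy tendsto_natCast_atTop_atTop
    rw [← tendsto_natCast_atTop_iff (R := ℝ)]
    refine h1.congr' ?_
    filter_upwards [eventually_gt_atTop 0] with t ht
    field_simp
  have h2 : Tendsto (fun t : ℕ => ((r t : ℝ) + 1) / t) atTop (nhds y) := by
    simpa [add_div] using hr.add tendsto_one_div_atTop_nhds_zero_nat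
  refine ((ha.comp htop).mul (h2.pow k)).congr fun t => ?_
  have : ((r t : ℝ) + 1) ^ k ≠ 0 := by positivity
  simp only [Function.comp_apply, div_pow]
  field_simp

theorem exists_abs_le_mul_pow {a : ℕ → ℝ} {k : ℕ} {L : ℝ}
    (ha : Tendsto (fun r : ℕ => a r / ((r : ℝ) + 1) ^ k) atTop (nhds L)) :
    ∃ K : ℝ, 0 ≤ K ∧ ∀ r t : ℕ, 1 ≤ t → r ≤ t → |a r / (t : ℝ) ^ k| ≤ K := by
  obtain ⟨K, hK⟩ := (Metric.isBounded_range_of_tendsto _ ha).exists_norm_le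
  have hK' : ∀ r : ℕ, |a r / ((r : ℝ) + 1) ^ k| ≤ K := fun r => hK _ ⟨r, rfl⟩
  have hK0 : 0 ≤ K := (abs_nonneg _).trans (hK' 0)
  refine ⟨K * 2 ^ k, by positivity, fun r t ht hrt => ?_⟩
  have ht' : (1 : ℝ) ≤ t := by exact_mod_cast ht
  have hrt' : (r : ℝ) ≤ t := by exact_mod_cast hrt
  have h1 := hK' r
  rw [abs_div, abs_of_pos (show (0 : ℝ) < ((r : ℝ) + 1) ^ k by positivity),
    div_le_iff₀ (by positivity)] at h1
  rw [abs_div, abs_of_pos (show (0 : ℝ) < (t : ℝ) ^ k by positivity), div_le_iff₀ (by positivity)]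
  calc |a r| ≤ K * ((r : ℝ) + 1) ^ k := h1
    _ ≤ K * (2 * t) ^ k := by gcongr; linarith
    _ = K * 2 ^ k * t ^ k := by rw [mul_pow]; ring

/-- Asymptotics of the sums `∑ a r * b (t - 2 * r)` for sequences of polynomial growth. -/
theorem tendsto_sum_mul_sub_two_mul {a b : ℕ → ℝ} {k l : ℕ} {L L' : ℝ}
    (ha : Tendsto (fun r : ℕ => a r / ((r : ℝ) + 1) ^ k) atTop (nhds L))
    (hb : Tendsto (fun r : ℕ => b r / ((r : ℝ) + 1) ^ l) atTop (nhds L')) :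
    Tendsto (fun t : ℕ => (∑ r ∈ Finset.range (t / 2 + 1), a r * b (t - 2 * r)) /
      (t : ℝ) ^ (k + l + 1)) atTop
      (nhds (L * L' * (∫ x in (0 : ℝ)..1, x ^ k * (1 - x) ^ l) / 2 ^ (k + 1))) := by
  let h : ℕ → ℕ → ℝ := fun t r =>
    if 2 * r ≤ t then (a r / (t : ℝ) ^ k) * (b (t - 2 * r) / (t : ℝ) ^ l) else 0
  let g : ℝ → ℝ := Set.indicator (Set.Iic (1 / 2)) fun y => (L * y ^ k) * (L' * (1 - 2 * y) ^ l)
  obtain ⟨Ka, hKa0, hKa⟩ := exists_abs_le_mul_pow ha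
  obtain ⟨Kb, hKb0, hKb⟩ := exists_abs_le_mul_pow hb
  have hsum : ∀ᶠ t : ℕ in atTop, ∫ y in (0 : ℝ)..1, h t ⌊(t : ℝ) * y⌋₊ =
      (∑ r ∈ Finset.range (t / 2 + 1), a r * b (t - 2 * r)) / (t : ℝ) ^ (k + l + 1) := by
    filter_upwards [eventually_ge_atTop 2] with t ht
    have ht0 : (t : ℝ) ≠ 0 := by positivity
    rw [intervalIntegral.integral_comp_mul_left (fun u => h t ⌊u⌋₊) ht0, mul_zero, mul_one,
      integral_comp_natFloor, ← Finset.sum_subset (s₁ := Finset.range (t / 2 + 1)),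
      Finset.sum_div, smul_eq_mul, Finset.mul_sum]
    · refine Finset.sum_congr rfl fun r hr => ?_
      have : 2 * r ≤ t := by have := Finset.mem_range.1 hr; omega
      simp only [h, if_pos this]
      field_simp
      ring
    · intro r hr
      simp only [Finset.mem_range] at hr ⊢
      omega
    · intro r _ hr
      simp only [Finset.mem_range] at hr
      exact if_neg (by omega)
  have hlim : Tendsto (fun t : ℕ => ∫ y in (0 : ℝ)..1, h t ⌊(t : ℝ) * y⌋₊) atTop
      (nhds (∫ y in (0 : ℝ)..1, g y)) := by
    refine intervalIntegral.tendsto_integral_filter_of_dominated_convergence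
      (fun _ => Ka * Kb) ?_ ?_ intervalIntegrable_const ?_
    · refine Eventually.of_forall fun t => Measurable.aestronglyMeasurable ?_
      exact (measurable_from_nat (f := h t)).comp
        (Nat.measurable_floor.comp (measurable_const_mul _))
    · filter_upwards [eventually_ge_atTop 1] with t ht
      refine Eventually.of_forall fun y _ => ?_
      simp only [h]
      split_ifs with hc
      · rw [Real.norm_eq_abs, abs_mul]
        exact mul_le_mul (hKa _ _ ht (by omega)) (hKb _ _ ht (by omega)) (abs_nonneg _) hKa0
      · simpa using mul_nonneg hKa0 hKb0
    · have hne : ∀ᵐ y : ℝ, y ≠ 1 / 2 := by simp [ae_iff]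
      filter_upwards [hne] with y hy hmem
      rw [Set.uIoc_of_le zero_le_one] at hmem
      have hfl : Tendsto (fun t : ℕ => (⌊(t : ℝ) * y⌋₊ : ℝ) / t) atTop (nhds y) := by
        simpa [mul_comm, Function.comp_def] using
          (tendsto_nat_floor_mul_div_atTop (R := ℝ) hmem.1.le).comp tendsto_natCast_atTop_atTop
      rcases lt_or_gt_of_ne hy with hlt | hgt
      · have hle : ∀ᶠ t : ℕ in atTop, 2 * ⌊(t : ℝ) * y⌋₊ ≤ t := by
          refine Eventually.of_forall fun t => ?_
          have h1 : (⌊(t : ℝ) * y⌋₊ : ℝ) ≤ t * y := Nat.floor_le (by have := hmem.1; positivity)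
          have h2 : (t : ℝ) * y ≤ t * (1 / 2) := by gcongr
          have : (2 : ℝ) * ⌊(t : ℝ) * y⌋₊ ≤ t := by linarith
          exact_mod_cast this
        have hfl' : Tendsto (fun t : ℕ => ((t - 2 * ⌊(t : ℝ) * y⌋₊ : ℕ) : ℝ) / t) atTop
            (nhds (1 - 2 * y)) := by
          refine (tendsto_const_nhds.sub (hfl.const_mul 2)).congr' ?_
          filter_upwards [hle, eventually_gt_atTop 0] with t ht ht0
          rw [Nat.cast_sub ht]
          push_cast
          field_simp
        have hg : g y = (L * y ^ k) * (L' * (1 - 2 * y) ^ l) :=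
          Set.indicator_of_mem (Set.mem_Iic.2 hlt.le) _
        rw [hg]
        refine ((tendsto_comp_div_pow ha hmem.1 hfl).mul
          (tendsto_comp_div_pow hb (by linarith) hfl')).congr' ?_
        filter_upwards [hle] with t ht
        simp only [h, if_pos ht]
      · have hg : g y = 0 := Set.indicator_of_notMem (by simpa using hgt) _
        rw [hg]
        refine tendsto_const_nhds.congr' ?_
        filter_upwards [hfl.eventually_const_lt hgt, eventually_gt_atTop 0] with t ht ht0
        have ht0' : (0 : ℝ) < t := by exact_mod_cast ht0
        rw [lt_div_iff₀ ht0'] at ht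
        refine (if_neg fun hc => ?_).symm
        have : (2 : ℝ) * ⌊(t : ℝ) * y⌋₊ ≤ t := by exact_mod_cast hc
        linarith
  have hval : ∫ y in (0 : ℝ)..1, g y =
      L * L' * (∫ x in (0 : ℝ)..1, x ^ k * (1 - x) ^ l) / 2 ^ (k + 1) := by
    have h1 : ∫ y in (0 : ℝ)..1, g y =
        ∫ y in (0 : ℝ)..(1 / 2), (L * y ^ k) * (L' * (1 - 2 * y) ^ l) :=
      intervalIntegral.integral_indicator ⟨by norm_num, by norm_num⟩
    have h2 := intervalIntegral.integral_comp_mul_left (a := 0) (b := 1 / 2)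
      (fun x : ℝ => x ^ k * (1 - x) ^ l) (two_ne_zero (α := ℝ))
    have h3 : ∀ y : ℝ, (L * y ^ k) * (L' * (1 - 2 * y) ^ l) =
        L * L' / 2 ^ k * ((2 * y) ^ k * (1 - 2 * y) ^ l) := fun y => by
      rw [mul_pow]; field_simp
    simp only [h3] at h1
    rw [h1, intervalIntegral.integral_const_mul, h2, mul_zero, mul_one_div_cancel two_ne_zero,
      smul_eq_mul, pow_succ]
    field_simp
  rw [← hval]
  exact hlim.congr' hsum

theorem tendsto_add_choose_div_pow (k : ℕ) :
    Tendsto (fun r : ℕ => ((r + k).choose k : ℝ) / ((r : ℝ) + 1) ^ k) atTop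
      (nhds (1 / k.factorial)) := by
  have h1 : Tendsto (fun r : ℕ => (∏ i ∈ Finset.range k, ((r : ℝ) + 1 + i) / (r + 1)) / k.factorial)
      atTop (nhds ((∏ i ∈ Finset.range k, 1) / k.factorial)) := by
    refine (tendsto_finsetProd _ fun i _ => ?_).div_const _
    have h2 : Tendsto (fun r : ℕ => 1 + (i : ℝ) * (1 / ((r : ℝ) + 1))) atTop (nhds (1 + i * 0)) :=
      tendsto_const_nhds.add (tendsto_one_div_add_atTop_nhds_zero_nat.const_mul _)
    rw [mul_zero, add_zero] at h2
    refine h2.congr fun r => ?_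
    field_simp
  rw [Finset.prod_const_one] at h1
  refine h1.congr fun r => ?_
  have h3 : (k.factorial : ℝ) * (r + k).choose k = ∏ i ∈ Finset.range k, ((r : ℝ) + 1 + i) := by
    have := Nat.ascFactorial_eq_factorial_mul_choose r k
    rw [← Nat.cast_mul, ← this, Nat.ascFactorial_eq_prod_range]
    push_cast
    rfl
  rw [Finset.prod_div_distrib, ← h3, Finset.prod_const, Finset.card_range]
  have := k.factorial_ne_zero
  field_simp

theorem tendsto_div_succ_pow_of_abs_sub_le {b : ℕ → ℝ} {n : ℕ} {α M : ℝ} (hn : 1 ≤ n)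
    (hb : ∀ t : ℕ, 1 ≤ t → |b t - α * (t : ℝ) ^ n| ≤ M * (t : ℝ) ^ (n - 1)) :
    Tendsto (fun t : ℕ => b t / ((t : ℝ) + 1) ^ n) atTop (nhds α) := by
  have h1 : Tendsto (fun t : ℕ => b t / (t : ℝ) ^ n) atTop (nhds α) := by
    rw [tendsto_iff_norm_sub_tendsto_zero]
    refine squeeze_zero' (Eventually.of_forall fun _ => norm_nonneg _) ?_
      (tendsto_const_div_atTop_nhds_zero_nat M)
    filter_upwards [eventually_ge_atTop 1] with t ht
    have ht0 : (0 : ℝ) < t := by exact_mod_cast ht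
    have h2 : b t / (t : ℝ) ^ n - α = (b t - α * (t : ℝ) ^ n) / (t : ℝ) ^ n := by
      field_simp
    rw [h2, norm_div, Real.norm_eq_abs, Real.norm_eq_abs, abs_of_pos (pow_pos ht0 n),
      div_le_div_iff₀ (pow_pos ht0 n) ht0]
    calc |b t - α * (t : ℝ) ^ n| * t ≤ M * (t : ℝ) ^ (n - 1) * t := by gcongr; exact hb t ht
      _ = M * (t : ℝ) ^ n := by rw [mul_assoc, pow_sub_one_mul (by omega)]
  have h3 := h1.mul ((tendsto_natCast_div_add_atTop (1 : ℝ)).pow n)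
  rw [one_pow, mul_one] at h3
  refine h3.congr' ?_
  filter_upwards [eventually_ge_atTop 1] with t ht
  have ht0 : (t : ℝ) ≠ 0 := by positivity
  rw [div_pow]
  field_simp

theorem sum_sum_mul_sub_two_mul (c f : ℕ → ℝ) (t : ℕ) :
    ∑ s ∈ Finset.range (t + 1), ∑ r ∈ Finset.range (s / 2 + 1), c r * f (s - 2 * r) =
      ∑ r ∈ Finset.range (t / 2 + 1), c r * ∑ m ∈ Finset.range (t - 2 * r + 1), f m := by
  rw [Finset.sum_comm' (t' := Finset.range (t / 2 + 1)) (s' := fun r => Finset.Ico (2 * r) (t + 1))]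
  · refine Finset.sum_congr rfl fun r hr => ?_
    rw [← Finset.mul_sum, Finset.sum_Ico_eq_sum_range]
    have := Finset.mem_range.1 hr
    rw [show t + 1 - 2 * r = t - 2 * r + 1 by omega]
    simp
  · intro s r
    simp only [Finset.mem_range, Finset.mem_Ico]
    omega

/-- Main asymptotic theorem for the harmonic counting function of a lattice in a cone. -/
theorem stmt_0 (n : ℕ) (hn : 2 ≤ n)
    (T : AddSubgroup (Fin n → ℤ))
    (A : Matrix (Fin n) (Fin n) ℝ) (hA : IsUnit A.det)
    (hgen : ∀ x : Fin n → ℤ, x ∈ T ↔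
      ∃ c : Fin n → ℤ, (fun i => (x i : ℝ)) = A.mulVec (fun j => (c j : ℝ)))
    (C : Set (Fin n → ℝ))
    (hCpos : C ⊆ {x | ∀ i, 0 ≤ x i})
    (hCcone : ∀ t : ℝ, 0 < t → ∀ x ∈ C, t • x ∈ C)
    (N : ℕ → ℕ)
    (hN : ∀ s : ℕ, N s = Set.ncard {x : Fin n → ℤ |
      x ∈ T ∧ (fun i => (x i : ℝ)) ∈ C ∧ ∑ i, (x i).natAbs = s})
    (α : ℝ)
    (hα : α = (volume ((fun v => A⁻¹.mulVec v) '' C ∩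
      {x : Fin n → ℝ | ∑ i, |x i| ≤ 1})).toReal)
    (M : ℝ) (hM : 0 < M)
    (hbound : ∀ t : ℕ, 1 ≤ t →
      |(∑ s ∈ Finset.range (t + 1), (N s : ℝ)) - α * (t : ℝ) ^ n| ≤ M * (t : ℝ) ^ (n - 1)) :
    Tendsto (fun t : ℕ =>
      (∑ s ∈ Finset.range (t + 1), ∑ r ∈ Finset.range (s / 2 + 1),
        ((r + n - 2).choose (n - 2) : ℝ) * (N (s - 2 * r) : ℝ)) / (t : ℝ) ^ (2 * n - 1))
      atTop
      (nhds (α * (∫ x in (0:ℝ)..1, x ^ (n - 2) * (1 - x) ^ n) /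
        ((n - 2).factorial * 2 ^ (n - 1)))) := by
  obtain ⟨k, rfl⟩ := Nat.exists_eq_add_of_le' hn
  have hlim := tendsto_sum_mul_sub_two_mul (tendsto_add_choose_div_pow k)
    (tendsto_div_succ_pow_of_abs_sub_le (b := fun t => ∑ s ∈ Finset.range (t + 1), (N s : ℝ))
      (by omega) hbound)
  simp only [← sum_sum_mul_sub_two_mul (fun r => ((r + k).choose k : ℝ)) fun s => (N s : ℝ)] at hlim
  rw [show 2 * (k + 2) - 1 = k + (k + 2) + 1 by omega]
  convert hlim using 2
  · simp only [← add_assoc, Nat.add_sub_cancel]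
  · rw [show k + 2 - 1 = k + 1 by omega, Nat.add_sub_cancel]
    field_simp
end

section
/- Let n ≥ 2, let q be a positive integer and p₁,…,pₙ integers each coprime to q, and let T = {a ∈ ℤⁿ : Σ_{j=1}^{n} aⱼpⱼ ≡ 0 (mod q)} be the associated preliminary lattice. Then lim_{t→∞} F_{T∩[0,∞)ⁿ}(t)/t^{2n−1} = 1/(2^{n−1} · (2n−1)! · q). -/
open Filter

/-- `f` lies between two shifted copies of `m ↦ m ^ k / K`. -/
def PowSandwich (f : ℕ → ℕ) (k K : ℕ) : Prop :=
  ∃ c : ℕ, ∀ m, K * f m ≤ (m + c) ^ k ∧ (m - c) ^ k ≤ K * f m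

lemma mul_pow_add_pow_le (d k x : ℕ) :
    d * (k + 1) * x ^ k + x ^ (k + 1) ≤ (x + d) ^ (k + 1) := by
  induction k with
  | zero => simp; omega
  | succ k ih =>
    calc d * (k + 1 + 1) * x ^ (k + 1) + x ^ (k + 1 + 1)
        ≤ (d * (k + 1) * x ^ k + x ^ (k + 1)) * (x + d) := by
          have : 0 ≤ d * (k + 1) * x ^ k * d := Nat.zero_le _
          ring_nf at this ⊢
          omega
      _ ≤ (x + d) ^ (k + 1) * (x + d) := by gcongr
      _ = _ := by ring

lemma add_pow_le_mul_pow_add (d k x : ℕ) :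
    (x + d) ^ (k + 1) ≤ d * (k + 1) * (x + d) ^ k + x ^ (k + 1) := by
  induction k with
  | zero => simp; omega
  | succ k ih =>
    have h : x ^ (k + 1) ≤ (x + d) ^ (k + 1) := by gcongr; omega
    calc (x + d) ^ (k + 1 + 1) = (x + d) ^ (k + 1) * x + d * (x + d) ^ (k + 1) := by ring
      _ ≤ (d * (k + 1) * (x + d) ^ k + x ^ (k + 1)) * x + d * (x + d) ^ (k + 1) := by gcongr
      _ ≤ (d * (k + 1) * (x + d) ^ k * (x + d) + x ^ (k + 1) * x)
          + d * (x + d) ^ (k + 1) := by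
          rw [add_mul]; gcongr; omega
      _ = _ := by ring

lemma pow_le_mul_pow_add_sub (d k x : ℕ) :
    x ^ (k + 1) ≤ d * (k + 1) * x ^ k + (x - d) ^ (k + 1) := by
  rcases le_total d x with h | h
  · obtain ⟨y, rfl⟩ := Nat.exists_eq_add_of_le' h
    simpa using add_pow_le_mul_pow_add d k y
  · calc x ^ (k + 1) = x * 1 * x ^ k := by ring
      _ ≤ d * (k + 1) * x ^ k := by gcongr; omega
      _ ≤ _ := Nat.le_add_right _ _

lemma mul_sum_le_pow (d k K c : ℕ) (R t : ℕ) (hR : d * R ≤ t) (h : ℕ → ℕ)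
    (hh : ∀ r, d * r ≤ t → K * h r ≤ (t - d * r + c) ^ k) :
    K * (d * (k + 1)) * ∑ r ∈ Finset.range (R + 1), h r ≤ (t + c + d) ^ (k + 1) := by
  suffices H : K * (d * (k + 1)) * ∑ r ∈ Finset.range (R + 1), h r + (t - d * R + c) ^ (k + 1)
      ≤ (t + c + d) ^ (k + 1) by omega
  induction R with
  | zero =>
    have h1 := mul_pow_add_pow_le d k (t + c)
    have h2 := Nat.mul_le_mul_left (d * (k + 1)) (hh 0 (by simp))
    simp only [zero_add, Finset.sum_range_one, mul_zero, Nat.sub_zero] at h2 ⊢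
    linarith
  | succ R ih =>
    have hle : d * R ≤ t := le_trans (Nat.mul_le_mul_left d (Nat.le_succ R)) hR
    have h0 := ih hle
    have h1 := mul_pow_add_pow_le d k (t - d * (R + 1) + c)
    have h2 := Nat.mul_le_mul_left (d * (k + 1)) (hh (R + 1) hR)
    have h3 : t - d * (R + 1) + c + d = t - d * R + c := by
      rw [mul_add] at hR ⊢; omega
    rw [h3] at h1
    rw [Finset.sum_range_succ, mul_add]
    linarith

lemma pow_le_mul_sum (d k K c : ℕ) (R t : ℕ) (hR : d * R ≤ t) (hR' : t < d * (R + 1))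
    (h : ℕ → ℕ) (hh : ∀ r, d * r ≤ t → (t - d * r - c) ^ k ≤ K * h r) :
    (t - c) ^ (k + 1) ≤ K * (d * (k + 1)) * ∑ r ∈ Finset.range (R + 1), h r := by
  have H : (t - c) ^ (k + 1) ≤ K * (d * (k + 1)) * ∑ r ∈ Finset.range (R + 1), h r
      + (t - d * (R + 1) - c) ^ (k + 1) := by
    clear hR'
    induction R with
    | zero =>
      have h1 := pow_le_mul_pow_add_sub d k (t - c)
      have h2 := Nat.mul_le_mul_left (d * (k + 1)) (hh 0 (by simp))
      rw [Nat.sub_right_comm] at h1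
      simp only [zero_add, Finset.sum_range_one, mul_zero, Nat.sub_zero, mul_one] at h2 ⊢
      linarith
    | succ R ih =>
      have h0 := ih (le_trans (Nat.mul_le_mul_left d (Nat.le_succ R)) hR)
      have h1 := pow_le_mul_pow_add_sub d k (t - d * (R + 1) - c)
      have h2 := Nat.mul_le_mul_left (d * (k + 1)) (hh (R + 1) hR)
      have h3 : t - d * (R + 1) - c - d = t - d * (R + 1 + 1) - c := by
        rw [mul_add d (R + 1) 1]; omega
      rw [h3] at h1
      rw [Finset.sum_range_succ, mul_add]
      linarith
  have h0 : t - d * (R + 1) - c = 0 := by omega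
  simpa [h0] using H

lemma PowSandwich.sum_step {f : ℕ → ℕ} {k K : ℕ} (hf : PowSandwich f k K) {d : ℕ} (hd : 0 < d) :
    PowSandwich (fun t => ∑ r ∈ Finset.range (t / d + 1), f (t - d * r)) (k + 1)
      (K * (d * (k + 1))) := by
  obtain ⟨c, hc⟩ := hf
  refine ⟨c + d, fun t => ⟨?_, ?_⟩⟩
  · rw [← add_assoc]
    exact mul_sum_le_pow d k K c _ t (Nat.mul_div_le t d) _ fun r _ => (hc _).1
  · refine le_trans (Nat.pow_le_pow_left (by omega) _)
      (pow_le_mul_sum d k K c _ t (Nat.mul_div_le t d) (Nat.lt_mul_div_succ t hd) _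
        fun r _ => (hc _).2)

lemma PowSandwich.tendsto {f : ℕ → ℕ} {k K : ℕ} (hf : PowSandwich f k K) (hK : 0 < K) :
    Tendsto (fun t : ℕ => (f t : ℝ) / (t : ℝ) ^ k) atTop (nhds (1 / (K : ℝ))) := by
  obtain ⟨c, hc⟩ := hf
  have hK' : (0 : ℝ) < K := by exact_mod_cast hK
  have hct : Tendsto (fun t : ℕ => (c : ℝ) / (t : ℝ)) atTop (nhds 0) :=
    tendsto_const_div_atTop_nhds_zero_nat _
  have hlo : Tendsto (fun t : ℕ => (1 - (c : ℝ) / t) ^ k / K) atTop (nhds (1 / (K : ℝ))) := by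
    simpa using ((hct.const_sub 1).pow k).div_const (K : ℝ)
  have hup : Tendsto (fun t : ℕ => (1 + (c : ℝ) / t) ^ k / K) atTop (nhds (1 / (K : ℝ))) := by
    simpa using ((hct.const_add 1).pow k).div_const (K : ℝ)
  refine tendsto_of_tendsto_of_tendsto_of_le_of_le' hlo hup ?_ ?_
  · filter_upwards [eventually_gt_atTop c] with t ht
    have ht0 : (0 : ℝ) < t := by exact_mod_cast (Nat.zero_le c).trans_lt ht
    have h : ((t : ℝ) - c) ^ k ≤ K * f t := by
      have := (hc t).2
      rw [← Nat.cast_sub ht.le]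
      exact_mod_cast this
    rw [one_sub_div ht0.ne', div_pow, div_div, div_le_div_iff₀ (by positivity) (by positivity)]
    nlinarith [mul_le_mul_of_nonneg_right h (pow_nonneg ht0.le k)]
  · filter_upwards [eventually_gt_atTop 0] with t ht
    have ht0 : (0 : ℝ) < t := by exact_mod_cast ht
    have h : (K : ℝ) * f t ≤ ((t : ℝ) + c) ^ k := by exact_mod_cast (hc t).1
    rw [one_add_div ht0.ne', div_pow, div_div, div_le_div_iff₀ (by positivity) (by positivity)]
    nlinarith [mul_le_mul_of_nonneg_right h (pow_nonneg ht0.le k)]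

lemma sum_range_choose_succ (j : ℕ) (S : ℕ → ℕ) (t : ℕ) :
    ∑ r ∈ Finset.range (t / 2 + 1), (r + (j + 1)).choose (j + 1) * S (t - 2 * r) =
      ∑ i ∈ Finset.range (t / 2 + 1), ∑ r ∈ Finset.range ((t - 2 * i) / 2 + 1),
        (r + j).choose j * S (t - 2 * i - 2 * r) := by
  induction t using Nat.strong_induction_on with
  | _ t ih =>
    rcases lt_or_ge t 2 with ht | ht
    · have : t / 2 = 0 := by omega
      simp [this]
    · obtain ⟨u, rfl⟩ := Nat.exists_eq_add_of_le' ht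
      have hd : (u + 2) / 2 = u / 2 + 1 := by omega
      have hsub : ∀ i, u + 2 - 2 * (i + 1) = u - 2 * i := fun i => by omega
      rw [hd, Finset.sum_range_succ' _ (u / 2 + 1)]
      conv_rhs => rw [Finset.sum_range_succ' _ (u / 2 + 1)]
      simp only [hsub]
      rw [← ih u (by omega)]
      simp only [mul_zero, Nat.sub_zero, hd]
      rw [Finset.sum_range_succ' _ (u / 2 + 1)]
      simp only [hsub, zero_add, Nat.choose_self, mul_zero, Nat.sub_zero]
      rw [← add_assoc, ← Finset.sum_add_distrib]
      congr 1
      refine Finset.sum_congr rfl fun r _ => ?_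
      rw [← add_mul, show r + 1 + (j + 1) = (r + j + 1) + 1 by ring, Nat.choose_succ_succ',
        show r + 1 + j = r + j + 1 by ring, show r + (j + 1) = r + j + 1 by ring]
      ring

lemma PowSandwich.sum_choose {S : ℕ → ℕ} {n q : ℕ} (hS : PowSandwich S n (n.factorial * q))
    (j : ℕ) :
    PowSandwich
      (fun t => ∑ r ∈ Finset.range (t / 2 + 1), (r + j).choose j * S (t - 2 * r))
      (n + j + 1) (2 ^ (j + 1) * (n + j + 1).factorial * q) := by
  induction j with
  | zero =>
    have := hS.sum_step two_pos
    simp only [add_zero, Nat.choose_zero_right, one_mul, zero_add]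
    convert this using 1
    rw [Nat.factorial_succ]; ring
  | succ j ih =>
    have := ih.sum_step two_pos
    simp only [sum_range_choose_succ]
    rw [show n + (j + 1) + 1 = n + j + 1 + 1 by ring, Nat.factorial_succ (n + j + 1)]
    convert this using 1
    ring

/-- The number of points of `ℕⁿ` of coordinate sum at most `m` satisfying
`∑ aⱼ pⱼ ≡ c (mod q)`. -/
noncomputable def simplexCount (q : ℕ) {n : ℕ} (p : Fin n → ℤ) (m : ℕ) (c : ℤ) : ℕ :=
  Nat.card {a : Fin n → ℕ // ∑ j, a j ≤ m ∧ (q : ℤ) ∣ ∑ j, (a j : ℤ) * p j - c}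

lemma finite_setOf_sum_le {n : ℕ} (m : ℕ) : {a : Fin n → ℕ | ∑ j, a j ≤ m}.Finite :=
  (Set.finite_Iic (fun _ : Fin n => m)).subset fun a ha i =>
    (Finset.single_le_sum (f := a) (fun _ _ => Nat.zero_le _) (Finset.mem_univ i)).trans ha

lemma simplexCount_succ (q : ℕ) {n : ℕ} (p : Fin (n + 1) → ℤ) (m : ℕ) (c : ℤ) :
    simplexCount q p m c =
      ∑ r ∈ Finset.range (m + 1),
        simplexCount q (fun j : Fin n => p j.succ) (m - r) (c - r * p 0) := by
  have hfin : ∀ r : Fin (m + 1), Finite {a : Fin n → ℕ // ∑ j, a j ≤ m - (r : ℕ) ∧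
      (q : ℤ) ∣ ∑ j, (a j : ℤ) * p j.succ - (c - (r : ℕ) * p 0)} := fun r =>
    ((finite_setOf_sum_le (m - (r : ℕ))).subset fun a ha => ha.1).to_subtype
  rw [Finset.sum_range]
  unfold simplexCount
  rw [← Nat.card_sigma]
  refine Nat.card_congr
    { toFun := fun a => ⟨⟨a.1 0, ?_⟩, ⟨fun j => a.1 j.succ, ?_, ?_⟩⟩
      invFun := fun x => ⟨Fin.cons (x.1 : ℕ) x.2.1, ?_, ?_⟩
      left_inv := ?_
      right_inv := ?_ }
  · have := a.2.1
    rw [Fin.sum_univ_succ] at this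
    omega
  · have := a.2.1
    rw [Fin.sum_univ_succ] at this
    simp only
    omega
  · have := a.2.2
    rw [Fin.sum_univ_succ] at this
    convert this using 1
    ring
  · have h1 := x.2.2.1
    have h2 := x.1.2
    simp only [Fin.sum_univ_succ, Fin.cons_zero, Fin.cons_succ]
    omega
  · have := x.2.2.2
    simp only [Fin.sum_univ_succ, Fin.cons_zero, Fin.cons_succ]
    convert this using 1
    ring
  · intro a
    ext j
    refine Fin.cases ?_ (fun i => ?_) j <;> simp
  · rintro ⟨r, a, ha⟩
    simp only [Fin.cons_zero, Fin.cons_succ, Fin.eta, Sigma.mk.injEq, true_and]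
    rfl

lemma simplexCount_one_bounds {q : ℕ} (hq : 0 < q) (p : Fin 1 → ℤ)
    (hp : IsCoprime (p 0) (q : ℤ)) (m : ℕ) (c : ℤ) :
    q * simplexCount q p m c ≤ m + q ∧ m - q ≤ q * simplexCount q p m c := by
  obtain ⟨u, v, huv⟩ := hp
  have hv : ∃ w : ℕ, ∀ x : ℕ, (q : ℤ) ∣ (x : ℤ) * p 0 - c ↔ x ≡ w [MOD q] := by
    have hq' : (q : ℤ) ≠ 0 := by exact_mod_cast hq.ne'
    refine ⟨((u * c) % q).toNat, fun x => ?_⟩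
    rw [Nat.ModEq.comm, Nat.modEq_iff_dvd, Int.toNat_of_nonneg (Int.emod_nonneg _ hq')]
    have hdiv := Int.mul_ediv_add_emod (u * c) q
    constructor
    · rintro ⟨y, hy⟩
      exact ⟨u * y + x * v + u * c / q, by linear_combination u * hy - (x : ℤ) * huv - hdiv⟩
    · rintro ⟨y, hy⟩
      exact ⟨p 0 * (y - u * c / q) - c * v, by
        linear_combination p 0 * hy + c * huv + p 0 * hdiv⟩
  obtain ⟨w, hw⟩ := hv
  have hcount : simplexCount q p m c = Nat.count (· ≡ w [MOD q]) (m + 1) := by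
    rw [Nat.count_eq_card_filter_range, ← Nat.card_eq_finsetCard]
    refine Nat.card_congr ((Equiv.funUnique (Fin 1) ℕ).subtypeEquiv fun a => ?_)
    simp [hw]
  have hmod := Nat.div_add_mod (m + 1) q
  have hlt := Nat.mod_lt (m + 1) hq
  rw [hcount, Nat.count_modEq_card _ hq, mul_add]
  split_ifs with h
  · rw [mul_one]; omega
  · rw [mul_zero]; omega

lemma simplexCount_bounds {q : ℕ} (hq : 0 < q) (k : ℕ) :
    ∃ c₀ : ℕ, ∀ (p : Fin (k + 1) → ℤ), (∀ j, IsCoprime (p j) (q : ℤ)) → ∀ (c : ℤ) (m : ℕ),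
      (k + 1).factorial * q * simplexCount q p m c ≤ (m + c₀) ^ (k + 1) ∧
      (m - c₀) ^ (k + 1) ≤ (k + 1).factorial * q * simplexCount q p m c := by
  induction k with
  | zero =>
    exact ⟨q, fun p hp c m => by simpa using simplexCount_one_bounds hq p (hp 0) m c⟩
  | succ k ih =>
    obtain ⟨c₀, h₀⟩ := ih
    refine ⟨c₀ + 1, fun p hp c m => ?_⟩
    have hK : (k + 1 + 1).factorial * q = (k + 1).factorial * q * (1 * (k + 1 + 1)) := by
      rw [Nat.factorial_succ (k + 1)]; ring
    rw [hK, simplexCount_succ]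
    constructor
    · rw [← add_assoc]
      exact mul_sum_le_pow 1 (k + 1) _ c₀ m m (by simp) _ fun r _ => by
        simpa using (h₀ _ (fun j => hp j.succ) _ (m - r)).1
    · refine le_trans (Nat.pow_le_pow_left (by omega) _)
        (pow_le_mul_sum 1 (k + 1) _ c₀ m m (by simp) (by simp) _ fun r _ => by
          simpa using (h₀ _ (fun j => hp j.succ) _ (m - r)).2)

lemma sum_ncard_eq_simplexCount (q : ℕ) {n : ℕ} (p : Fin n → ℤ) (m : ℕ) :
    ∑ s ∈ Finset.range (m + 1), Set.ncard {a : Fin n → ℤ |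
      (q : ℤ) ∣ (∑ j, a j * p j) ∧ (∀ i, 0 ≤ a i) ∧ ∑ i, (a i).natAbs = s} =
    simplexCount q p m 0 := by
  have hfin : ∀ s : ℕ, {a : Fin n → ℤ |
      (q : ℤ) ∣ (∑ j, a j * p j) ∧ (∀ i, 0 ≤ a i) ∧ ∑ i, (a i).natAbs = s}.Finite := by
    intro s
    refine (Set.finite_Icc (fun _ : Fin n => (0 : ℤ)) (fun _ => (s : ℤ))).subset
      fun a ha => ⟨ha.2.1, fun i => ?_⟩
    have h := Finset.single_le_sum (f := fun i => (a i).natAbs) (fun _ _ => Nat.zero_le _)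
      (Finset.mem_univ i)
    have h0 := ha.2.1 i
    have h1 := ha.2.2
    simp only at h ⊢
    omega
  have hfin' : ∀ s : Fin (m + 1), Finite {a : Fin n → ℤ |
      (q : ℤ) ∣ (∑ j, a j * p j) ∧ (∀ i, 0 ≤ a i) ∧ ∑ i, (a i).natAbs = (s : ℕ)} :=
    fun s => (hfin s).to_subtype
  rw [Finset.sum_range]
  simp only [← Nat.card_coe_set_eq]
  rw [← Nat.card_sigma]
  unfold simplexCount
  refine Nat.card_congr
    { toFun := fun x => ⟨fun j => (x.2.1 j).natAbs, ?_, ?_⟩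
      invFun := fun a => ⟨⟨∑ j, a.1 j, ?_⟩, ⟨fun j => (a.1 j : ℤ), ?_, ?_, ?_⟩⟩
      left_inv := ?_
      right_inv := ?_ }
  · have h1 := x.2.2.2.2
    have h2 := x.1.2
    exact h1.le.trans (Nat.le_of_lt_succ h2)
  · have h1 := x.2.2.1
    have h2 := x.2.2.2.1
    simpa [abs_of_nonneg (h2 _)] using h1
  · have := a.2.1
    omega
  · simpa using a.2.2
  · intro i; simp
  · simp
  · rintro ⟨⟨s, hs⟩, ⟨a, h1, h2, h3⟩⟩
    simp only at h3
    subst h3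
    simp [abs_of_nonneg (h2 _)]
  · rintro ⟨a, h1, h2⟩
    simp

lemma sum_sum_range_half {R : Type*} [CommSemiring R] (c N : ℕ → R) (t : ℕ) :
    ∑ s ∈ Finset.range (t + 1), ∑ r ∈ Finset.range (s / 2 + 1), c r * N (s - 2 * r) =
      ∑ r ∈ Finset.range (t / 2 + 1), c r * ∑ u ∈ Finset.range (t - 2 * r + 1), N u := by
  rw [Finset.sum_comm' (t' := Finset.range (t / 2 + 1))
    (s' := fun r => Finset.Ico (2 * r) (t + 1))
    (by intro s r; simp only [Finset.mem_range, Finset.mem_Ico]; omega)]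
  refine Finset.sum_congr rfl fun r hr => ?_
  rw [Finset.mem_range] at hr
  rw [Finset.sum_Ico_eq_sum_range, Finset.mul_sum, show t + 1 - 2 * r = t - 2 * r + 1 by omega]
  simp

/-- The limit of the harmonic counting function of a preliminary lattice over the
positive orthant equals `1/(2^(n-1)·(2n-1)!·q)`. -/
theorem stmt_2 (n : ℕ) (hn : 2 ≤ n) (q : ℕ) (hq : 0 < q)
    (p : Fin n → ℤ) (hp : ∀ j, IsCoprime (p j) (q : ℤ))
    (N : ℕ → ℕ)
    (hN : ∀ s : ℕ, N s = Set.ncard {a : Fin n → ℤ |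
      (q : ℤ) ∣ (∑ j, a j * p j) ∧ (∀ i, 0 ≤ a i) ∧ ∑ i, (a i).natAbs = s}) :
    Tendsto (fun t : ℕ =>
      (∑ s ∈ Finset.range (t + 1), ∑ r ∈ Finset.range (s / 2 + 1),
        ((r + n - 2).choose (n - 2) : ℝ) * (N (s - 2 * r) : ℝ)) / (t : ℝ) ^ (2 * n - 1))
      atTop
      (nhds (1 / ((2 : ℝ) ^ (n - 1) * (2 * n - 1).factorial * q))) := by
  obtain ⟨j, rfl⟩ := Nat.exists_eq_add_of_le' hn
  have hS : PowSandwich (fun m => ∑ s ∈ Finset.range (m + 1), N s) (j + 2)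
      ((j + 2).factorial * q) := by
    obtain ⟨c₀, h₀⟩ := simplexCount_bounds hq (j + 1)
    refine ⟨c₀, fun m => ?_⟩
    simp only [hN, sum_ncard_eq_simplexCount]
    exact h₀ p hp 0 m
  have hlim := (hS.sum_choose j).tendsto (by positivity)
  have e1 : 2 * (j + 2) - 1 = j + 2 + j + 1 := by omega
  have e2 : j + 2 - 1 = j + 1 := by omega
  have e3 : j + 2 - 2 = j := by omega
  have e4 : ∀ r, r + (j + 2) - 2 = r + j := fun r => by omega
  simp only [e1, e2, e3, e4]
  convert hlim using 2
  · rw [sum_sum_range_half (fun r => ((r + j).choose j : ℝ)) (fun u => (N u : ℝ))]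
    push_cast
    rfl
  · push_cast
    rfl
end

section
/- Let T₁ and T₂ be full-rank sublattices of ℤⁿ such that for every k ∈ ℕ the cardinalities card(T₁ ∩ B_{ℓ¹}(0,k)) and card(T₂ ∩ B_{ℓ¹}(0,k)) are equal. Then T₁ and T₂ have equal covolume; that is, if A₁ and A₂ are generating matrices of T₁ and T₂ respectively, then |det A₁| = |det A₂|. -/
open Filter Topology MeasureTheory

/-- The closed unit ball of the `ℓ¹`-norm on `ℝⁿ`. -/
def unitL1Ball (n : ℕ) : Set (Fin n → ℝ) := {x | ∑ i, |x i| ≤ 1}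

theorem convex_unitL1Ball (n : ℕ) : Convex ℝ (unitL1Ball n) := by
  intro x hx y hy a b ha hb hab
  simp only [unitL1Ball, Set.mem_ofPred_eq] at hx hy ⊢
  calc ∑ i, |(a • x + b • y) i| ≤ ∑ i, (a * |x i| + b * |y i|) := by
        refine Finset.sum_le_sum fun i _ => ?_
        simp only [Pi.add_apply, Pi.smul_apply, smul_eq_mul]
        refine (abs_add_le _ _).trans_eq ?_
        rw [abs_mul, abs_mul, abs_of_nonneg ha, abs_of_nonneg hb]
    _ = a * ∑ i, |x i| + b * ∑ i, |y i| := by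
        rw [Finset.sum_add_distrib, Finset.mul_sum, Finset.mul_sum]
    _ ≤ 1 := by nlinarith

theorem isCompact_unitL1Ball (n : ℕ) : IsCompact (unitL1Ball n) := by
  refine (isCompact_closedBall (0 : Fin n → ℝ) 1).of_isClosed_subset ?_ fun x hx => ?_
  · exact isClosed_le (by fun_prop) continuous_const
  · rw [mem_closedBall_zero_iff, pi_norm_le_iff_of_nonneg zero_le_one]
    exact fun i => (Finset.single_le_sum (f := fun i => |x i|) (fun i _ => abs_nonneg _)
      (Finset.mem_univ i)).trans hx

theorem volume_real_unitL1Ball_pos (n : ℕ) : 0 < volume.real (unitL1Ball n) := by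
  refine ENNReal.toReal_pos (ne_of_gt ?_) (isCompact_unitL1Ball n).measure_ne_top
  have hopen : IsOpen {x : Fin n → ℝ | ∑ i, |x i| < 1} :=
    isOpen_lt (by fun_prop) continuous_const
  refine (hopen.measure_pos volume ⟨0, by simp⟩).trans_le (measure_mono fun x hx => ?_)
  exact (show ∑ i, |x i| < 1 from hx).le

/-- The number of points of the lattice `A ℤⁿ` in the `ℓ¹`-ball of radius `k`, divided by `kⁿ`,
tends to the volume of the unit ball divided by `|det A|`. -/
theorem tendsto_ncard_range_mulVec_l1Ball (n : ℕ) (A : Matrix (Fin n) (Fin n) ℤ)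
    (hA : Function.Injective A.mulVec) :
    Tendsto (fun k : ℕ =>
      (Set.ncard {x : Fin n → ℤ | x ∈ Set.range A.mulVec ∧ ∑ i, (x i).natAbs ≤ k} : ℝ) / k ^ n)
      atTop (𝓝 (|(A.det : ℝ)⁻¹| * volume.real (unitL1Ball n))) := by
  have hdet : A.det ≠ 0 := by
    intro h
    obtain ⟨v, hv, h0⟩ := Matrix.exists_mulVec_eq_zero_iff.mpr h
    exact hv (hA (by rw [h0, Matrix.mulVec_zero]))
  set f : (Fin n → ℝ) →ₗ[ℝ] (Fin n → ℝ) := Matrix.toLin' (A.map (Int.cast : ℤ → ℝ)) with hf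
  have hfdet : LinearMap.det f = (A.det : ℝ) := by
    rw [hf, LinearMap.det_toLin']
    exact (RingHom.map_det (Int.castRingHom ℝ) A).symm
  have hfdet0 : LinearMap.det f ≠ 0 := by rw [hfdet]; exact_mod_cast hdet
  have hfint (z : Fin n → ℤ) (i : Fin n) : f (fun j => (z j : ℝ)) i = (A.mulVec z i : ℤ) := by
    simp [hf, Matrix.toLin'_apply, Matrix.mulVec, dotProduct]
  set s : Set (Fin n → ℝ) := f ⁻¹' unitL1Ball n with hs
  have hcomp : IsCompact s :=
    (f.equivOfDetNeZero hfdet0).toContinuousLinearEquiv.toHomeomorph.isCompact_preimage.mpr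
      (isCompact_unitL1Ball n)
  have hvol : volume.real s = |(A.det : ℝ)⁻¹| * volume.real (unitL1Ball n) := by
    rw [Measure.real, hs, Measure.addHaar_preimage_linearMap volume hfdet0, ENNReal.toReal_mul,
      ENNReal.toReal_ofReal (abs_nonneg _), hfdet, Measure.real]
  have key := tendsto_card_div_pow_atTop_volume s hcomp.isBounded hcomp.isClosed.measurableSet
    (((convex_unitL1Ball n).linear_preimage f).addHaar_frontier volume)
  rw [hvol] at key
  refine key.congr' ?_
  filter_upwards [eventually_gt_atTop 0] with k hk
  have hk' : (0 : ℝ) < k := by exact_mod_cast hk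
  rw [Fintype.card_fin]
  congr 2
  set P : Set (Fin n → ℤ) := {z | ∑ i, (A.mulVec z i).natAbs ≤ k} with hP
  have h1 : {x : Fin n → ℤ | x ∈ Set.range A.mulVec ∧ ∑ i, (x i).natAbs ≤ k} =
      A.mulVec '' P := by
    ext x
    constructor
    · rintro ⟨⟨z, rfl⟩, hz⟩
      exact ⟨z, hz, rfl⟩
    · rintro ⟨z, hz, rfl⟩
      exact ⟨⟨z, rfl⟩, hz⟩
  have hmem (z : Fin n → ℤ) : (k : ℝ)⁻¹ • (fun j => (z j : ℝ)) ∈ s ↔ z ∈ P := by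
    simp only [hs, hP, unitL1Ball, Set.mem_preimage, Set.mem_ofPred_eq, map_smul, Pi.smul_apply,
      smul_eq_mul, abs_mul, hfint, ← Finset.mul_sum]
    rw [abs_of_pos (inv_pos.mpr hk'), inv_mul_le_iff₀ hk', mul_one, ← Nat.cast_le (α := ℝ)]
    simp [Nat.cast_natAbs]
  have hinj : Function.Injective
      fun z : Fin n → ℤ => (k : ℝ)⁻¹ • (fun j => (z j : ℝ) : Fin n → ℝ) := by
    intro z w h
    have h' := smul_right_injective _ (inv_ne_zero hk'.ne') h
    funext j
    exact_mod_cast congrFun h' j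
  rw [h1, Set.ncard_image_of_injective _ hA, ← Set.ncard_image_of_injective P hinj,
    Nat.card_coe_set_eq]
  congr 1
  ext x
  rw [Set.mem_inter_iff, Set.mem_smul_set]
  constructor
  · rintro ⟨hx, y, hy, rfl⟩
    rw [SetLike.mem_coe, Module.Basis.mem_span_iff_repr_mem] at hy
    choose z hz using hy
    have hyz : y = fun j => (z j : ℝ) := by
      funext j
      simpa using (hz j).symm
    subst hyz
    exact ⟨z, (hmem z).mp hx, rfl⟩
  · rintro ⟨z, hz, rfl⟩
    refine ⟨(hmem z).mpr hz, _, ?_, rfl⟩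
    rw [SetLike.mem_coe, Module.Basis.mem_span_iff_repr_mem]
    exact fun j => ⟨z j, by simp⟩

/-- Two full-rank sublattices of `ℤⁿ` with identical ℓ¹-ball point counts have
equal covolume: their generating matrices have equal `|det|`. -/
theorem stmt_4 (n : ℕ)
    (T₁ T₂ : AddSubgroup (Fin n → ℤ))
    (A₁ A₂ : Matrix (Fin n) (Fin n) ℤ)
    (hA₁ : Function.Injective A₁.mulVec)
    (hr₁ : Set.range A₁.mulVec = (T₁ : Set (Fin n → ℤ)))
    (hA₂ : Function.Injective A₂.mulVec)
    (hr₂ : Set.range A₂.mulVec = (T₂ : Set (Fin n → ℤ)))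
    (hcount : ∀ k : ℕ,
      Set.ncard {x : Fin n → ℤ | x ∈ T₁ ∧ ∑ i, (x i).natAbs ≤ k} =
      Set.ncard {x : Fin n → ℤ | x ∈ T₂ ∧ ∑ i, (x i).natAbs ≤ k}) :
    A₁.det.natAbs = A₂.det.natAbs := by
  have t₁ := tendsto_ncard_range_mulVec_l1Ball n A₁ hA₁
  have t₂ := tendsto_ncard_range_mulVec_l1Ball n A₂ hA₂
  simp only [hr₁, SetLike.mem_coe, hcount] at t₁
  simp only [hr₂, SetLike.mem_coe] at t₂
  have h := mul_right_cancel₀ (volume_real_unitL1Ball_pos n).ne' (tendsto_nhds_unique t₁ t₂)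
  rw [abs_inv, abs_inv, inv_inj] at h
  rw [← Int.natAbs_abs A₁.det, ← Int.natAbs_abs A₂.det]
  congr 1
  exact_mod_cast h
end

section
/- Let n ≥ 2 be an integer. Then lim_{t→∞} (1/t^{2n−1}) · Σ_{r=0}^{⌊t/2⌋} C(r+n−2, n−2) · (t−2r)ⁿ = (1/((n−2)! · 2^{n−1})) · ∫₀¹ x^{n−2}(1−x)ⁿ dx, where the limit is over positive integers t and C(a,b) denotes the binomial coefficient. -/
open Filter

/-- Integrating a function of the integer part over `[0, t]` yields the sum of its values. -/
lemma integral_comp_natFloor_s8 (f : ℕ → ℝ) (t : ℕ) :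
    ∫ y in (0:ℝ)..t, f ⌊y⌋₊ = ∑ r ∈ Finset.range t, f r := by
  have hae (k : ℕ) : ∀ᵐ y : ℝ, y ∈ Set.uIoc (k : ℝ) ((k + 1 : ℕ) : ℝ) → f k = f ⌊y⌋₊ := by
    filter_upwards [MeasureTheory.Measure.ae_ne MeasureTheory.volume ((k + 1 : ℕ) : ℝ)] with
      y hy hmem
    rw [Set.uIoc_of_le (by push_cast; linarith)] at hmem
    have : ⌊y⌋₊ = k := by
      rw [Nat.floor_eq_iff (k.cast_nonneg.trans hmem.1.le)]
      exact ⟨hmem.1.le, by exact_mod_cast lt_of_le_of_ne hmem.2 hy⟩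
    rw [this]
  have hint (k : ℕ) : IntervalIntegrable (fun y : ℝ => f ⌊y⌋₊) MeasureTheory.volume
      (k : ℝ) ((k + 1 : ℕ) : ℝ) :=
    (intervalIntegrable_const (c := f k)).congr_ae
      ((MeasureTheory.ae_restrict_iff' measurableSet_uIoc).2 (hae k))
  have h := intervalIntegral.sum_integral_adjacent_intervals (n := t)
    (a := fun k : ℕ => (k : ℝ)) (fun k _ => hint k)
  rw [Nat.cast_zero] at h
  rw [← h]
  refine Finset.sum_congr rfl fun k _ => ?_
  rw [← intervalIntegral.integral_congr_ae (hae k)]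
  simp

lemma sum_range_eq_mul_integral_natFloor (f : ℕ → ℝ) (t : ℕ) :
    ∑ r ∈ Finset.range t, f r = t * ∫ u in (0:ℝ)..1, f ⌊t * u⌋₊ := by
  rw [intervalIntegral.mul_integral_comp_mul_left (f := fun y : ℝ => f ⌊y⌋₊) (c := (t : ℝ)),
    mul_zero, mul_one, integral_comp_natFloor_s8]

lemma tendsto_choose_add_div_pow {N : ℕ → ℕ} {u : ℝ} (m : ℕ)
    (hN : Tendsto (fun t : ℕ => (N t : ℝ) / t) atTop (nhds u)) :
    Tendsto (fun t : ℕ => ((N t + m).choose m : ℝ) / (t : ℝ) ^ m) atTop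
      (nhds (u ^ m / m.factorial)) := by
  have key : ∀ t : ℕ, ((N t + m).choose m : ℝ) / (t : ℝ) ^ m =
      (∏ i ∈ Finset.range m, ((N t : ℝ) / t + ((1 + i : ℕ) : ℝ) / t)) / m.factorial := by
    intro t
    have h := Nat.ascFactorial_eq_factorial_mul_choose (N t) m
    rw [Nat.ascFactorial_eq_prod_range] at h
    have h' : (∏ i ∈ Finset.range m, ((N t : ℝ) + 1 + i)) =
        m.factorial * ((N t + m).choose m : ℝ) := by exact_mod_cast h
    simp_rw [← add_div, Finset.prod_div_distrib, Finset.prod_const, Finset.card_range]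
    have h2 : (∏ i ∈ Finset.range m, ((N t : ℝ) + ((1 + i : ℕ) : ℝ))) =
        m.factorial * ((N t + m).choose m : ℝ) := by
      rw [← h']
      exact Finset.prod_congr rfl fun i _ => by push_cast; ring
    rw [h2]
    have : (m.factorial : ℝ) ≠ 0 := by positivity
    field_simp
  simp_rw [key]
  refine Tendsto.div_const ?_ _
  have := tendsto_finsetProd (Finset.range m)
    (fun i _ => hN.add (tendsto_const_div_atTop_nhds_zero_nat ((1 + i : ℕ) : ℝ)))
  simpa using this

lemma tendsto_natSub_two_mul_div {N : ℕ → ℕ} {u : ℝ}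
    (hN : Tendsto (fun t : ℕ => (N t : ℝ) / t) atTop (nhds u)) :
    Tendsto (fun t : ℕ => ((t - 2 * N t : ℕ) : ℝ) / t) atTop (nhds (max (1 - 2 * u) 0)) := by
  refine Tendsto.congr' ?_ (((hN.const_mul 2).const_sub 1).max tendsto_const_nhds)
  filter_upwards [eventually_gt_atTop 0] with t ht
  have ht' : (0 : ℝ) < t := by exact_mod_cast ht
  rcases le_total (2 * N t) t with h | h
  · have h' : (2 : ℝ) * N t ≤ t := by exact_mod_cast h
    rw [Nat.cast_sub h, max_eq_left]
    · push_cast; field_simp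
    · rw [← mul_div_assoc, sub_nonneg, div_le_one ht']; exact h'
  · have h' : (t : ℝ) ≤ 2 * N t := by exact_mod_cast h
    rw [Nat.sub_eq_zero_of_le h, max_eq_right]
    · simp
    · rw [← mul_div_assoc, sub_nonpos, one_le_div ht']; exact h'

lemma integral_pow_mul_max_pow (m : ℕ) :
    ∫ u in (0:ℝ)..1, u ^ m / m.factorial * max (1 - 2 * u) 0 ^ (m + 2) =
      1 / (m.factorial * 2 ^ (m + 1)) * ∫ x in (0:ℝ)..1, x ^ m * (1 - x) ^ (m + 2) := by
  have hc : Continuous fun u : ℝ => u ^ m / m.factorial * max (1 - 2 * u) 0 ^ (m + 2) := by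
    fun_prop
  rw [← intervalIntegral.integral_add_adjacent_intervals (b := 1 / 2)
    (hc.intervalIntegrable _ _) (hc.intervalIntegrable _ _)]
  have hright : ∫ u in (1 / 2 : ℝ)..1, u ^ m / m.factorial * max (1 - 2 * u) 0 ^ (m + 2) = 0 := by
    rw [intervalIntegral.integral_congr (g := fun _ => 0), intervalIntegral.integral_zero]
    intro u hu
    rw [Set.uIcc_of_le (by norm_num)] at hu
    simp [max_eq_right (show 1 - 2 * u ≤ 0 by linarith [hu.1])]
  have hleft : ∫ u in (0 : ℝ)..1 / 2, u ^ m / m.factorial * max (1 - 2 * u) 0 ^ (m + 2) =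
      ∫ u in (0 : ℝ)..1 / 2, (1 / (m.factorial * 2 ^ m)) *
        ((2 * u) ^ m * (1 - 2 * u) ^ (m + 2)) := by
    refine intervalIntegral.integral_congr fun u hu => ?_
    rw [Set.uIcc_of_le (by norm_num)] at hu
    simp only [max_eq_left (show 0 ≤ 1 - 2 * u by linarith [hu.2]), mul_pow]
    field_simp
  rw [hright, hleft, add_zero, intervalIntegral.integral_const_mul,
    intervalIntegral.integral_comp_mul_left (fun x : ℝ => x ^ m * (1 - x) ^ (m + 2))
      (two_ne_zero)]
  norm_num [pow_succ]
  ring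

lemma sum_choose_mul_pow_div_eq_integral (m : ℕ) {t : ℕ} (ht : 0 < t) :
    (∑ r ∈ Finset.range (t / 2 + 1),
      ((r + m).choose m : ℝ) * ((t - 2 * r : ℕ) : ℝ) ^ (m + 2)) / (t : ℝ) ^ (2 * m + 3) =
    ∫ u in (0:ℝ)..1, ((⌊t * u⌋₊ + m).choose m : ℝ) / (t : ℝ) ^ m *
      (((t - 2 * ⌊t * u⌋₊ : ℕ) : ℝ) / t) ^ (m + 2) := by
  have ht' : (t : ℝ) ≠ 0 := by positivity
  have hsub : Finset.range (t / 2 + 1) ⊆ Finset.range t := by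
    intro r; simp only [Finset.mem_range]; omega
  rw [Finset.sum_subset hsub, sum_range_eq_mul_integral_natFloor
    (fun r => ((r + m).choose m : ℝ) * ((t - 2 * r : ℕ) : ℝ) ^ (m + 2)),
    ← intervalIntegral.integral_const_mul, ← intervalIntegral.integral_div]
  · congr 1
    funext u
    rw [div_pow]
    field_simp
    ring
  · intro r _ hr
    rw [Finset.mem_range] at hr
    rw [Nat.sub_eq_zero_of_le (by omega)]
    simp

lemma choose_div_pow_mul_pow_le {m t N : ℕ} (ht : 0 < t) (hN : N ≤ t) :
    ((N + m).choose m : ℝ) / (t : ℝ) ^ m * (((t - 2 * N : ℕ) : ℝ) / t) ^ (m + 2) ≤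
      (1 + m : ℝ) ^ m := by
  have ht' : (0 : ℝ) < t := by exact_mod_cast ht
  have hchoose : ((N + m).choose m : ℝ) ≤ (1 + m : ℝ) ^ m * (t : ℝ) ^ m := by
    rw [← mul_pow]
    have h : (N + m).choose m ≤ ((1 + m) * t) ^ m :=
      (Nat.choose_le_pow _ _).trans (Nat.pow_le_pow_left (by nlinarith) _)
    exact_mod_cast h
  have hsub : ((t - 2 * N : ℕ) : ℝ) / t ≤ 1 := by
    rw [div_le_one ht']
    exact_mod_cast Nat.sub_le _ _
  calc _ ≤ (1 + m : ℝ) ^ m * 1 := by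
        gcongr
        · rwa [div_le_iff₀ (by positivity)]
        · exact pow_le_one₀ (by positivity) hsub
    _ = _ := mul_one _

/-- The key Riemann-sum limit:
`lim_{t→∞} (1/t^(2n−1)) Σ_{r=0}^{⌊t/2⌋} C(r+n−2,n−2)·(t−2r)ⁿ
  = (1/((n−2)!·2^(n−1))) ∫₀¹ x^(n−2)(1−x)ⁿ dx`. -/
theorem stmt_8 (n : ℕ) (hn : 2 ≤ n) :
    Tendsto (fun t : ℕ =>
      (∑ r ∈ Finset.range (t / 2 + 1),
        ((r + n - 2).choose (n - 2) : ℝ) * ((t - 2 * r : ℕ) : ℝ) ^ n) / (t : ℝ) ^ (2 * n - 1))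
      atTop
      (nhds ((1 / ((n - 2).factorial * 2 ^ (n - 1))) *
        ∫ x in (0:ℝ)..1, x ^ (n - 2) * (1 - x) ^ n)) := by
  obtain ⟨m, rfl⟩ := Nat.exists_eq_add_of_le' hn
  simp only [show ∀ r, r + (m + 2) - 2 = r + m from fun r => rfl, Nat.add_sub_cancel,
    show m + 2 - 1 = m + 1 from rfl, show 2 * (m + 2) - 1 = 2 * m + 3 by omega]
  rw [← integral_pow_mul_max_pow]
  refine Tendsto.congr' (EventuallyEq.symm ((eventually_gt_atTop 0).mono fun t ht =>
    sum_choose_mul_pow_div_eq_integral m ht)) ?_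
  refine intervalIntegral.tendsto_integral_filter_of_dominated_convergence
    (fun _ => (1 + m : ℝ) ^ m) ?_ ?_ intervalIntegrable_const ?_
  · refine Eventually.of_forall fun t => Measurable.aestronglyMeasurable ?_
    exact (measurable_from_nat (f := fun N : ℕ => ((N + m).choose m : ℝ) / (t : ℝ) ^ m *
      (((t - 2 * N : ℕ) : ℝ) / t) ^ (m + 2))).comp
        (Nat.measurable_floor.comp (measurable_const_mul (t : ℝ)))
  · filter_upwards [eventually_gt_atTop 0] with t ht
    refine Eventually.of_forall fun u hu => ?_
    rw [Set.uIoc_of_le zero_le_one] at hu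
    rw [Real.norm_of_nonneg (by positivity)]
    exact choose_div_pow_mul_pow_le ht
      (Nat.floor_le_of_le (mul_le_of_le_one_right t.cast_nonneg hu.2))
  · refine Eventually.of_forall fun u hu => ?_
    rw [Set.uIoc_of_le zero_le_one] at hu
    have hN : Tendsto (fun t : ℕ => (⌊t * u⌋₊ : ℝ) / t) atTop (nhds u) := by
      simpa only [Function.comp_def, mul_comm u] using
        (tendsto_nat_floor_mul_div_atTop hu.1.le).comp tendsto_natCast_atTop_atTop
    exact (tendsto_choose_add_div_pow m hN).mul ((tendsto_natSub_two_mul_div hN).pow _)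
end

section
/- Let n ≥ 2 be an integer, let N : ℕ → [0,∞) be a function, and suppose there exist real numbers α ≥ 0 and M > 0 such that |Σ_{i=0}^{t} N(i) − α tⁿ| ≤ M t^{n−1} for every integer t ≥ 1. Then lim_{t→∞} (1/t^{2n−1}) · Σ_{r=0}^{⌊t/2⌋} C(r+n−2, n−2) · Σ_{i=0}^{t−2r} N(i) = (α/((n−2)! · 2^{n−1})) · ∫₀¹ x^{n−2}(1−x)ⁿ dx. -/
open Filter

open MeasureTheory Topology in
/-- A normalized sum is the integral of the corresponding step function. -/
theorem sum_range_div_eq_integral_floor (g : ℕ → ℝ) {t : ℕ} (ht : t ≠ 0) :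
    (∑ r ∈ Finset.range t, g r) / t = ∫ x in (0:ℝ)..1, g ⌊(t:ℝ) * x⌋₊ := by
  have hpiece : ∀ r : ℕ, ∀ᵐ x : ℝ, x ∈ Set.uIoc (r:ℝ) ((r + 1 : ℕ) : ℝ) → g r = g ⌊x⌋₊ := by
    intro r
    filter_upwards [Measure.ae_ne volume ((r + 1 : ℕ) : ℝ)] with x hx hmem
    rw [Set.uIoc_of_le (by push_cast; linarith)] at hmem
    rw [(Nat.floor_eq_iff (r.cast_nonneg.trans hmem.1.le)).2
      ⟨hmem.1.le, by exact_mod_cast lt_of_le_of_ne hmem.2 hx⟩]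
  have hint : ∀ r < t, IntervalIntegrable (fun x : ℝ => g ⌊x⌋₊) volume
      (r:ℝ) ((r + 1 : ℕ) : ℝ) := by
    intro r _
    refine (intervalIntegrable_const (c := g r)).congr_ae ?_
    rw [EventuallyEq, ae_restrict_iff' measurableSet_uIoc]
    exact hpiece r
  have hsum := intervalIntegral.sum_integral_adjacent_intervals hint
  have hval : ∀ r : ℕ, ∫ x in (r:ℝ)..((r + 1 : ℕ) : ℝ), g ⌊x⌋₊ = g r := by
    intro r
    rw [← intervalIntegral.integral_congr_ae (hpiece r)]
    simp
  simp only [hval] at hsum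
  have ht' : (t:ℝ) ≠ 0 := by exact_mod_cast ht
  rw [hsum, intervalIntegral.integral_comp_mul_left (fun x : ℝ => g ⌊x⌋₊) ht']
  simp [div_eq_inv_mul]

open MeasureTheory Topology in
/-- Convergence of uniformly bounded Riemann-type sums whose step functions converge pointwise. -/
theorem tendsto_sum_range_div_integral {F : ℕ → ℕ → ℝ} {f : ℝ → ℝ} {C : ℝ}
    (hF : ∀ t r : ℕ, 1 ≤ t → r ≤ t → |F t r| ≤ C)
    (hlim : ∀ x : ℝ, 0 < x → Tendsto (fun t : ℕ => F t ⌊(t:ℝ) * x⌋₊) atTop (𝓝 (f x))) :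
    Tendsto (fun t : ℕ => (∑ r ∈ Finset.range t, F t r) / t) atTop
      (𝓝 (∫ x in (0:ℝ)..1, f x)) := by
  have key : Tendsto (fun t : ℕ => ∫ x in (0:ℝ)..1, F t ⌊(t:ℝ) * x⌋₊) atTop
      (𝓝 (∫ x in (0:ℝ)..1, f x)) := by
    refine intervalIntegral.tendsto_integral_filter_of_dominated_convergence (fun _ => C)
      ?_ ?_ intervalIntegrable_const ?_
    · refine Eventually.of_forall fun t => Measurable.aestronglyMeasurable ?_
      exact (measurable_from_top (f := F t)).comp
        (Nat.measurable_floor.comp (measurable_const.mul measurable_id))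
    · filter_upwards [eventually_ge_atTop 1] with t ht
      refine Eventually.of_forall fun x hx => hF t _ ht ?_
      rw [Set.uIoc_of_le zero_le_one] at hx
      refine Nat.floor_le_of_le ?_
      exact mul_le_of_le_one_right t.cast_nonneg hx.2
    · refine Eventually.of_forall fun x hx => hlim x ?_
      rw [Set.uIoc_of_le zero_le_one] at hx
      exact hx.1
  refine key.congr' ?_
  filter_upwards [eventually_ne_atTop 0] with t ht
  exact (sum_range_div_eq_integral_floor (F t) ht).symm

open Topology in
theorem tendsto_floor_mul_div_natCast {x : ℝ} (hx : 0 < x) :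
    Tendsto (fun t : ℕ => (⌊(t:ℝ) * x⌋₊ : ℝ) / t) atTop (𝓝 x) := by
  have := (tendsto_nat_floor_mul_div_atTop hx.le).comp (tendsto_natCast_atTop_atTop (R := ℝ))
  refine this.congr fun t => ?_
  simp [mul_comm]

open Topology in
theorem tendsto_choose_floor_mul_div_pow (k : ℕ) {x : ℝ} (hx : 0 < x) :
    Tendsto (fun t : ℕ => ((⌊(t:ℝ) * x⌋₊ + k).choose k : ℝ) / (t:ℝ) ^ k) atTop
      (𝓝 (x ^ k / k.factorial)) := by
  have hprod : Tendsto (fun t : ℕ => ∏ i ∈ Finset.range k,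
      ((⌊(t:ℝ) * x⌋₊ : ℝ) / t + ((1 + i : ℕ) : ℝ) / t)) atTop
      (𝓝 (∏ _i ∈ Finset.range k, (x + 0))) :=
    tendsto_finsetProd _ fun i _ => (tendsto_floor_mul_div_natCast hx).add
      (tendsto_const_div_atTop_nhds_zero_nat _)
  simp only [add_zero, Finset.prod_const, Finset.card_range] at hprod
  refine (hprod.div_const (k.factorial : ℝ)).congr fun t => ?_
  have h := Nat.ascFactorial_eq_factorial_mul_choose ⌊(t:ℝ) * x⌋₊ k
  rw [Nat.ascFactorial_eq_prod_range] at h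
  have h' := congrArg (Nat.cast (R := ℝ)) h
  push_cast at h'
  have hk : (k.factorial : ℝ) ≠ 0 := by exact_mod_cast k.factorial_ne_zero
  simp only [← add_div, Finset.prod_div_distrib, Finset.prod_const, Finset.card_range]
  push_cast
  simp only [← add_assoc]
  rw [h']
  field_simp

theorem choose_add_div_pow_le (k : ℕ) {t r : ℕ} (ht : 1 ≤ t) (hr : r ≤ t) :
    ((r + k).choose k : ℝ) / (t:ℝ) ^ k ≤ (1 + k : ℝ) ^ k := by
  have h : (r + k).choose k ≤ ((1 + k) * t) ^ k :=
    (Nat.choose_le_pow _ _).trans (Nat.pow_le_pow_left (by nlinarith) k)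
  have ht' : (0:ℝ) < t := by exact_mod_cast ht
  rw [div_le_iff₀ (by positivity), ← mul_pow]
  exact_mod_cast h

open Topology in
theorem tendsto_natCast_sub_two_mul_floor_div {x : ℝ} (hx : 0 < x) :
    Tendsto (fun t : ℕ => ((t - 2 * ⌊(t:ℝ) * x⌋₊ : ℕ) : ℝ) / t) atTop
      (𝓝 (max (1 - 2 * x) 0)) := by
  have h : Tendsto (fun t : ℕ => max (1 - 2 * ((⌊(t:ℝ) * x⌋₊ : ℝ) / t)) 0) atTop
      (𝓝 (max (1 - 2 * x) 0)) :=
    (((tendsto_floor_mul_div_natCast hx).const_mul 2).const_sub 1).max tendsto_const_nhds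
  refine h.congr' ?_
  filter_upwards [eventually_gt_atTop 0] with t ht
  have ht' : (0:ℝ) < t := by exact_mod_cast ht
  rcases le_total (2 * ⌊(t:ℝ) * x⌋₊) t with hle | hle
  · have hle' : 2 * (⌊(t:ℝ) * x⌋₊ : ℝ) ≤ t := by exact_mod_cast hle
    rw [Nat.cast_sub hle, max_eq_left]
    · push_cast
      field_simp
    · rw [← mul_div_assoc, sub_nonneg, div_le_one ht']
      exact hle'
  · have hle' : (t:ℝ) ≤ 2 * (⌊(t:ℝ) * x⌋₊ : ℝ) := by exact_mod_cast hle
    rw [Nat.sub_eq_zero_of_le hle, max_eq_right]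
    · simp
    · rw [← mul_div_assoc, sub_nonpos, one_le_div ht']
      exact hle'

theorem integral_pow_mul_max_one_sub_two_mul_pow (k : ℕ) {n : ℕ} (hn : n ≠ 0) :
    ∫ x in (0:ℝ)..1, x ^ k * (max (1 - 2 * x) 0) ^ n =
      (1 / 2 ^ (k + 1)) * ∫ x in (0:ℝ)..1, x ^ k * (1 - x) ^ n := by
  have hcont : Continuous fun x : ℝ => x ^ k * (max (1 - 2 * x) 0) ^ n := by fun_prop
  rw [← intervalIntegral.integral_add_adjacent_intervals
    (hcont.intervalIntegrable 0 (1 / 2)) (hcont.intervalIntegrable (1 / 2) 1)]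
  have hright : ∫ x in (1 / 2 : ℝ)..1, x ^ k * (max (1 - 2 * x) 0) ^ n = 0 := by
    rw [intervalIntegral.integral_congr (g := fun _ => (0:ℝ)) ?_]
    · simp
    · intro x hx
      rw [Set.uIcc_of_le (by norm_num)] at hx
      simp [max_eq_right (show 1 - 2 * x ≤ 0 by linarith [hx.1]), hn]
  have hleft : ∫ x in (0 : ℝ)..(1 / 2), x ^ k * (max (1 - 2 * x) 0) ^ n =
      ∫ x in (0 : ℝ)..(1 / 2), (1 / 2 ^ k) * ((2 * x) ^ k * (1 - 2 * x) ^ n) := by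
    refine intervalIntegral.integral_congr fun x hx => ?_
    rw [Set.uIcc_of_le (by norm_num)] at hx
    simp only [max_eq_left (show 0 ≤ 1 - 2 * x by linarith [hx.2]), mul_pow]
    field_simp
  rw [hright, hleft, intervalIntegral.integral_const_mul,
    intervalIntegral.integral_comp_mul_left (fun x : ℝ => x ^ k * (1 - x) ^ n) two_ne_zero]
  norm_num [pow_succ]
  ring

open Topology in
/-- Abstract squeeze lemma: if the partial sums of a nonnegative `N : ℕ → [0,∞)` satisfy
`|Σ_{i=0}^{t} N(i) − α tⁿ| ≤ M t^(n−1)`, then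
`lim_{t→∞} (1/t^(2n−1)) Σ_{r=0}^{⌊t/2⌋} C(r+n−2,n−2) Σ_{i=0}^{t−2r} N(i)
  = (α/((n−2)!·2^(n−1))) ∫₀¹ x^(n−2)(1−x)ⁿ dx`. -/
theorem stmt_10 (n : ℕ) (hn : 2 ≤ n)
    (N : ℕ → ℝ) (hNpos : ∀ i, 0 ≤ N i)
    (α : ℝ) (hα : 0 ≤ α) (M : ℝ) (hM : 0 < M)
    (hbound : ∀ t : ℕ, 1 ≤ t →
      |(∑ i ∈ Finset.range (t + 1), N i) - α * (t : ℝ) ^ n| ≤ M * (t : ℝ) ^ (n - 1)) :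
    Tendsto (fun t : ℕ =>
      (∑ r ∈ Finset.range (t / 2 + 1),
        ((r + n - 2).choose (n - 2) : ℝ) * ∑ i ∈ Finset.range (t - 2 * r + 1), N i) /
        (t : ℝ) ^ (2 * n - 1))
      atTop
      (nhds ((α / ((n - 2).factorial * 2 ^ (n - 1))) *
        ∫ x in (0:ℝ)..1, x ^ (n - 2) * (1 - x) ^ n)) := by
  obtain ⟨k, rfl⟩ : ∃ k, n = k + 2 := ⟨n - 2, by omega⟩
  have e1 : k + 2 - 2 = k := by omega
  have e2 : k + 2 - 1 = k + 1 := by omega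
  have e3 : 2 * (k + 2) - 1 = k + (k + 2) + 1 := by omega
  have e4 : ∀ r, r + (k + 2) - 2 = r + k := fun r => by omega
  simp only [e1, e2, e3, e4] at hbound ⊢
  set S : ℕ → ℝ := fun m => ∑ i ∈ Finset.range (m + 1), N i with hS
  let T : ℕ → ℕ → ℝ := fun t r => if 2 * r ≤ t then S (t - 2 * r) else 0
  have hT : ∀ t r : ℕ, 1 ≤ t →
      |T t r - α * ((t - 2 * r : ℕ) : ℝ) ^ (k + 2)| ≤ (M + N 0) * (t:ℝ) ^ (k + 1) := by
    intro t r ht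
    have ht' : (1:ℝ) ≤ (t:ℝ) ^ (k + 1) := one_le_pow₀ (by exact_mod_cast ht)
    have hN0 := hNpos 0
    rcases lt_trichotomy (2 * r) t with h | h | h
    · simp only [T, if_pos h.le]
      refine (hbound (t - 2 * r) (by omega)).trans ?_
      have : ((t - 2 * r : ℕ) : ℝ) ^ (k + 1) ≤ (t:ℝ) ^ (k + 1) := by
        gcongr
        omega
      nlinarith
    · have h0 : t - 2 * r = 0 := by omega
      simp only [T, if_pos h.le, h0, hS]
      simp only [zero_add, Finset.sum_range_one, Nat.cast_zero, ne_eq, Nat.add_eq_zero_iff,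
        OfNat.ofNat_ne_zero, and_false, not_false_eq_true, zero_pow, mul_zero, sub_zero,
        abs_of_nonneg hN0]
      nlinarith
    · have h0 : t - 2 * r = 0 := by omega
      simp only [T, if_neg h.not_ge, h0]
      simp
      positivity
  let F : ℕ → ℕ → ℝ := fun t r =>
    ((r + k).choose k : ℝ) / (t:ℝ) ^ k * (T t r / (t:ℝ) ^ (k + 2))
  have hFbound : ∀ t r : ℕ, 1 ≤ t → r ≤ t → |F t r| ≤ (1 + k : ℝ) ^ k * (α + (M + N 0)) := by
    intro t r ht hr
    have ht' : (1:ℝ) ≤ t := by exact_mod_cast ht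
    have hN0 := hNpos 0
    rw [abs_mul, abs_of_nonneg (by positivity)]
    refine mul_le_mul (choose_add_div_pow_le k ht hr) ?_ (abs_nonneg _) (by positivity)
    rw [abs_div, abs_of_nonneg (by positivity : (0:ℝ) ≤ (t:ℝ) ^ (k + 2)),
      div_le_iff₀ (by positivity)]
    have h1 : α * ((t - 2 * r : ℕ) : ℝ) ^ (k + 2) ≤ α * (t:ℝ) ^ (k + 2) := by
      gcongr
      omega
    have h2 : (M + N 0) * (t:ℝ) ^ (k + 1) ≤ (M + N 0) * (t:ℝ) ^ (k + 2) := by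
      exact mul_le_mul_of_nonneg_left (pow_le_pow_right₀ ht' (by omega)) (by positivity)
    have h3 : 0 ≤ α * ((t - 2 * r : ℕ) : ℝ) ^ (k + 2) := by positivity
    have h4 := abs_le.1 (hT t r ht)
    rw [abs_le]
    constructor <;> nlinarith [h4.1, h4.2]
  have hFlim : ∀ x : ℝ, 0 < x → Tendsto (fun t : ℕ => F t ⌊(t:ℝ) * x⌋₊) atTop
      (𝓝 (x ^ k / k.factorial * (α * (max (1 - 2 * x) 0) ^ (k + 2)))) := by
    intro x hx
    refine (tendsto_choose_floor_mul_div_pow k hx).mul ?_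
    have hmain := ((tendsto_natCast_sub_two_mul_floor_div hx).pow (k + 2)).const_mul α
    have herr : Tendsto (fun t : ℕ => T t ⌊(t:ℝ) * x⌋₊ / (t:ℝ) ^ (k + 2) -
        α * (((t - 2 * ⌊(t:ℝ) * x⌋₊ : ℕ) : ℝ) / t) ^ (k + 2)) atTop (𝓝 0) := by
      refine squeeze_zero_norm' ?_ (tendsto_const_div_atTop_nhds_zero_nat (M + N 0))
      filter_upwards [eventually_ge_atTop 1] with t ht
      have ht' : (0:ℝ) < t := by exact_mod_cast ht
      rw [div_pow, ← mul_div_assoc, ← sub_div, Real.norm_eq_abs, abs_div,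
        abs_of_pos (by positivity : (0:ℝ) < (t:ℝ) ^ (k + 2)), div_le_div_iff₀ (by positivity) ht']
      calc _ ≤ (M + N 0) * (t:ℝ) ^ (k + 1) * t := by
            gcongr
            exact hT t _ ht
        _ = _ := by ring
    simpa using herr.add hmain
  have hlim := tendsto_sum_range_div_integral hFbound hFlim
  have hval : ∫ x in (0:ℝ)..1, x ^ k / k.factorial * (α * (max (1 - 2 * x) 0) ^ (k + 2)) =
      α / (k.factorial * 2 ^ (k + 1)) * ∫ x in (0:ℝ)..1, x ^ k * (1 - x) ^ (k + 2) := by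
    have : ∀ x : ℝ, x ^ k / k.factorial * (α * (max (1 - 2 * x) 0) ^ (k + 2)) =
        α / k.factorial * (x ^ k * (max (1 - 2 * x) 0) ^ (k + 2)) := fun x => by ring
    simp only [this]
    rw [intervalIntegral.integral_const_mul,
      integral_pow_mul_max_one_sub_two_mul_pow k (by omega)]
    have hk : (k.factorial : ℝ) ≠ 0 := by exact_mod_cast k.factorial_ne_zero
    field_simp
  rw [hval] at hlim
  refine hlim.congr' ?_
  filter_upwards [eventually_ge_atTop 1] with t ht
  rw [pow_succ, ← div_div]
  congr 1
  rw [Finset.sum_div]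
  symm
  refine Finset.sum_subset_zero_on_sdiff (Finset.range_subset_range.2 (by omega)) ?_ ?_
  · intro r hr
    have : ¬ 2 * r ≤ t := by
      simp only [Finset.mem_sdiff, Finset.mem_range] at hr
      omega
    simp [F, T, this]
  · intro r hr
    have : 2 * r ≤ t := by
      simp only [Finset.mem_range] at hr
      omega
    simp only [F, T, if_pos this]
    rw [pow_add, div_mul_div_comm]
end

section
/- Let n ≥ 2, let T be a full-rank sublattice of ℤⁿ with generating matrix A, and let C ⊆ [0,∞)ⁿ be a cone with apex at the origin. Set N(s) = card{x ∈ T ∩ C : ‖x‖₁ = s} and α = Vol(A⁻¹(C) ∩ B_{ℓ¹}(0,1)), and assume α > 0 and that there is M > 0 with |Σ_{s=0}^{t} N(s) − α tⁿ| ≤ M t^{n−1} for all integers t ≥ 1. Then lim_{t→∞} F_{T∩C}(t) / (t^{n−1} · card(T ∩ C ∩ B_{ℓ¹}(0,t))) = B(n−1, n+1) / ((n−2)! · 2^{n−1}); that is, the number of independent eigenfunctions associated with the lattice points of C ∩ B_{ℓ¹}(0,t) is asymptotically B(n−1,n+1)/((n−2)!2^{n−1}) · t^{n−1} times the number of such lattice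 points. -/
open MeasureTheory Filter

lemma pow_succ_sub_pow_succ_bounds {a b : ℝ} (hb : 0 ≤ b) (hab : b ≤ a) (p : ℕ) :
    (p + 1) * b ^ p * (a - b) ≤ a ^ (p + 1) - b ^ (p + 1) ∧
      a ^ (p + 1) - b ^ (p + 1) ≤ (p + 1) * a ^ p * (a - b) := by
  have ha : 0 ≤ a := hb.trans hab
  induction p with
  | zero => simp
  | succ p ih =>
    obtain ⟨ih₁, ih₂⟩ := ih
    have hpow : b ^ (p + 1) ≤ a ^ (p + 1) := by gcongr
    have hsub : 0 ≤ a - b := sub_nonneg.2 hab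
    push_cast
    constructor
    · have h1 := mul_le_mul_of_nonneg_left ih₁ hb
      have h2 := mul_le_mul_of_nonneg_right hpow hsub
      have e : a ^ (p + 1 + 1) - b ^ (p + 1 + 1) =
        a ^ (p + 1) * (a - b) + b * (a ^ (p + 1) - b ^ (p + 1)) := by ring
      rw [e]
      calc _ = b ^ (p + 1) * (a - b) + b * ((p + 1) * b ^ p * (a - b)) := by ring
        _ ≤ _ := add_le_add h2 h1
    · have h1 := mul_le_mul_of_nonneg_left ih₂ ha
      have h2 := mul_le_mul_of_nonneg_right hpow hsub
      have e : a ^ (p + 1 + 1) - b ^ (p + 1 + 1) =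
        b ^ (p + 1) * (a - b) + a * (a ^ (p + 1) - b ^ (p + 1)) := by ring
      rw [e]
      calc _ ≤ a ^ (p + 1) * (a - b) + a * ((p + 1) * a ^ p * (a - b)) := add_le_add h2 h1
        _ = _ := by ring

lemma abs_pow_succ_sub_le {x : ℝ} (hx : 0 ≤ x) (q : ℕ) :
    |(x + 2) ^ (q + 2) - x ^ (q + 2) - 2 * (q + 2) * (x + 2) ^ (q + 1)| ≤
      4 * (q + 2) * (q + 1) * (x + 2) ^ q := by
  have hle : x ≤ x + 2 := by linarith
  obtain ⟨h1, h2⟩ := pow_succ_sub_pow_succ_bounds hx hle (q + 1)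
  have h3 := (pow_succ_sub_pow_succ_bounds hx hle q).2
  have h4 := mul_le_mul_of_nonneg_left h3 (by positivity : (0 : ℝ) ≤ 2 * (q + 2))
  push_cast at h1 h2
  have : (0 : ℝ) ≤ 4 * (q + 2) * (q + 1) * (x + 2) ^ q := by positivity
  rw [abs_le]
  constructor <;> ring_nf at * <;> linarith

lemma exists_abs_sub_le_of_two_step_recurrence {G H : ℕ → ℝ}
    (hrec : ∀ t, G (t + 2) = G t + H (t + 2)) {a M : ℝ} {q : ℕ}
    (hH : ∀ t : ℕ, |H t - a * (t : ℝ) ^ (q + 1)| ≤ M * ((t : ℝ) + 1) ^ q) :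
    ∃ M' : ℝ, ∀ t : ℕ,
      |G t - a / (2 * (q + 2)) * (t : ℝ) ^ (q + 2)| ≤ M' * ((t : ℝ) + 1) ^ (q + 1) := by
  set c : ℝ := a / (2 * (q + 2)) with hc
  have ha : a = c * (2 * (q + 2)) := by rw [hc]; field_simp
  set K : ℝ := |c| * (4 * (q + 2) * (q + 1)) with hK
  have hM : 0 ≤ M := by
    have := (abs_nonneg _).trans (hH 0)
    simpa using this
  have hK0 : 0 ≤ K := by positivity
  refine ⟨M + K + |G 0| + |G 1 - c|, fun t => ?_⟩
  set M' : ℝ := M + K + |G 0| + |G 1 - c| with hM'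
  have hMK : M + K ≤ M' := by
    have := abs_nonneg (G 0); have := abs_nonneg (G 1 - c); linarith
  have hM'0 : 0 ≤ M' := by linarith
  induction t using Nat.twoStepInduction with
  | zero =>
    have := abs_nonneg (G 1 - c)
    simp; linarith
  | one =>
    have h : (1 : ℝ) ≤ ((1 : ℕ) + 1 : ℝ) ^ (q + 1) := one_le_pow₀ (by norm_num)
    have := abs_nonneg (G 0)
    calc _ = |G 1 - c| := by simp
      _ ≤ M' * 1 := by linarith
      _ ≤ _ := by gcongr
  | more t ih _ =>
    have hx : (0 : ℝ) ≤ t := t.cast_nonneg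
    have h1 := hH (t + 2)
    have h2 := abs_pow_succ_sub_le hx q
    rw [hrec]
    push_cast at h1 ⊢
    set x : ℝ := (t : ℝ)
    have e : G t + H (t + 2) - c * (x + 2) ^ (q + 2) =
      (G t - c * x ^ (q + 2)) + (H (t + 2) - a * (x + 2) ^ (q + 1)) -
        c * ((x + 2) ^ (q + 2) - x ^ (q + 2) - 2 * (q + 2) * (x + 2) ^ (q + 1)) := by
      rw [ha]; ring
    have h3 : |c * ((x + 2) ^ (q + 2) - x ^ (q + 2) - 2 * (q + 2) * (x + 2) ^ (q + 1))| ≤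
        K * (x + 2 + 1) ^ q := by
      rw [abs_mul, hK, mul_assoc |c|]
      have h : (x + 2) ^ q ≤ (x + 2 + 1) ^ q := pow_le_pow_left₀ (by linarith) (by linarith) q
      exact mul_le_mul_of_nonneg_left (h2.trans (mul_le_mul_of_nonneg_left h (by positivity)))
        (abs_nonneg c)
    have h4 : (x + 1) ^ (q + 1) ≤ (x + 1) * (x + 2 + 1) ^ q := by
      rw [pow_succ']
      gcongr
      linarith
    have h5 : 0 ≤ (x + 2 + 1) ^ q := by positivity
    rw [e]
    calc _ ≤ |(G t - c * x ^ (q + 2)) + (H (t + 2) - a * (x + 2) ^ (q + 1))| + _ := abs_sub _ _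
      _ ≤ |G t - c * x ^ (q + 2)| + |H (t + 2) - a * (x + 2) ^ (q + 1)| + _ := by
        gcongr; exact abs_add_le _ _
      _ ≤ M' * ((x + 1) * (x + 2 + 1) ^ q) + M * (x + 2 + 1) ^ q + K * (x + 2 + 1) ^ q := by
        gcongr
        exact ih.trans (by gcongr)
      _ = (M' * (x + 1) + (M + K)) * (x + 2 + 1) ^ q := by ring
      _ ≤ (M' * (x + 2 + 1)) * (x + 2 + 1) ^ q := by
        gcongr; linarith
      _ = _ := by ring

/-- The coefficient of `x ^ s` in `(1 - x ^ 2)⁻ᵏ * ∑ i, N i * x ^ i`. -/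
noncomputable def harmonicConv (N : ℕ → ℕ) (k s : ℕ) : ℝ :=
  ∑ r ∈ Finset.range (s / 2 + 1), (k.multichoose r : ℝ) * (N (s - 2 * r) : ℝ)

lemma harmonicConv_zero (N : ℕ → ℕ) (s : ℕ) : harmonicConv N 0 s = N s := by
  rw [harmonicConv, Finset.sum_range_succ']
  simp

lemma harmonicConv_succ_add_two (N : ℕ → ℕ) (k s : ℕ) :
    harmonicConv N (k + 1) (s + 2) = harmonicConv N (k + 1) s + harmonicConv N k (s + 2) := by
  have h : (s + 2) / 2 + 1 = s / 2 + 1 + 1 := by omega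
  simp only [harmonicConv, h]
  rw [Finset.sum_range_succ', Finset.sum_range_succ' (fun r => (k.multichoose r : ℝ) * _),
    ← add_assoc, ← Finset.sum_add_distrib]
  congr 1
  · refine Finset.sum_congr rfl fun r _ => ?_
    have : s + 2 - 2 * (r + 1) = s - 2 * r := by omega
    rw [Nat.multichoose_succ_succ, this]
    push_cast
    ring
  · simp

lemma sum_harmonicConv_succ_add_two (N : ℕ → ℕ) (k t : ℕ) :
    ∑ s ∈ Finset.range (t + 2 + 1), harmonicConv N (k + 1) s =
      ∑ s ∈ Finset.range (t + 1), harmonicConv N (k + 1) s +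
        ∑ s ∈ Finset.range (t + 2 + 1), harmonicConv N k s := by
  have h : t + 2 + 1 = t + 1 + 1 + 1 := rfl
  rw [h, Finset.sum_range_succ', Finset.sum_range_succ',
    Finset.sum_range_succ' (harmonicConv N k),
    Finset.sum_range_succ' (fun s => harmonicConv N k (s + 1))]
  simp only [add_assoc, Nat.reduceAdd, harmonicConv_succ_add_two, Finset.sum_add_distrib]
  simp [harmonicConv]

lemma exists_abs_sum_harmonicConv_sub_le {N : ℕ → ℕ} {α M : ℝ} {m : ℕ}
    (hS : ∀ t : ℕ, |∑ s ∈ Finset.range (t + 1), (N s : ℝ) - α * (t : ℝ) ^ (m + 1)| ≤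
      M * ((t : ℝ) + 1) ^ m) (k : ℕ) :
    ∃ M' : ℝ, ∀ t : ℕ,
      |∑ s ∈ Finset.range (t + 1), harmonicConv N k s -
        α * (m + 1).factorial / (2 ^ k * (m + 1 + k).factorial) * (t : ℝ) ^ (m + k + 1)| ≤
        M' * ((t : ℝ) + 1) ^ (m + k) := by
  induction k with
  | zero =>
    have : ((m + 1).factorial : ℝ) ≠ 0 := by positivity
    refine ⟨M, fun t => ?_⟩
    simpa [harmonicConv_zero, this] using hS t
  | succ k ih =>
    obtain ⟨M', hM'⟩ := ih
    obtain ⟨M'', h⟩ := exists_abs_sub_le_of_two_step_recurrence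
      (G := fun t => ∑ s ∈ Finset.range (t + 1), harmonicConv N (k + 1) s)
      (sum_harmonicConv_succ_add_two N k) hM'
    have e : α * (m + 1).factorial / (2 ^ (k + 1) * (m + 1 + (k + 1)).factorial) =
        α * (m + 1).factorial / (2 ^ k * (m + 1 + k).factorial) / (2 * ((m + k : ℕ) + 2)) := by
      rw [← add_assoc (m + 1), Nat.factorial_succ (m + 1 + k)]
      push_cast
      have : (m + 1 + k + 1 : ℝ) ≠ 0 := by positivity
      have : (m + k + 2 : ℝ) ≠ 0 := by positivity
      field_simp
      ring
    exact ⟨M'', fun t => by rw [e]; exact h t⟩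

lemma integral_pow_mul_one_sub_pow (a b : ℕ) :
    ∫ x in (0 : ℝ)..1, x ^ a * (1 - x) ^ b =
      (a.factorial * b.factorial : ℝ) / (a + b + 1).factorial := by
  induction a generalizing b with
  | zero =>
    have h := intervalIntegral.integral_comp_sub_left (a := 0) (b := 1) (fun x : ℝ => x ^ b) 1
    simp only [pow_zero, one_mul, h, Nat.factorial_succ, zero_add]
    have : (b.factorial : ℝ) ≠ 0 := by positivity
    simp
    field_simp
  | succ a ih =>
    have h := intervalIntegral.integral_mul_deriv_eq_deriv_mul (a := 0) (b := 1)
      (u := fun x : ℝ => x ^ (a + 1)) (u' := fun x : ℝ => (a + 1) * x ^ a)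
      (v := fun x : ℝ => -(1 - x) ^ (b + 1) / (b + 1)) (v' := fun x : ℝ => (1 - x) ^ b)
      (fun x _ => by simpa using hasDerivAt_pow (a + 1) x)
      (fun x _ => by
        have := ((((hasDerivAt_id x).const_sub 1).pow (b + 1)).neg).div_const (b + 1 : ℝ)
        refine this.congr_deriv ?_
        have : (b + 1 : ℝ) ≠ 0 := by positivity
        push_cast
        simp only [id]
        field_simp)
      (Continuous.intervalIntegrable (by fun_prop) _ _)
      (Continuous.intervalIntegrable (by fun_prop) _ _)
    rw [h]
    have e : ∀ x : ℝ, (a + 1) * x ^ a * (-(1 - x) ^ (b + 1) / (b + 1)) =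
      (-(a + 1) / (b + 1)) * (x ^ a * (1 - x) ^ (b + 1)) := fun x => by ring
    simp only [e, intervalIntegral.integral_const_mul, ih (b + 1)]
    have h1 : a + (b + 1) + 1 = a + 1 + b + 1 := by ring
    rw [h1, Nat.factorial_succ a, Nat.factorial_succ b]
    push_cast
    have : (b + 1 : ℝ) ≠ 0 := by positivity
    simp
    field_simp
    ring

lemma tendsto_div_pow_of_abs_sub_le {G : ℕ → ℝ} {a M : ℝ} {q : ℕ}
    (h : ∀ t : ℕ, |G t - a * (t : ℝ) ^ (q + 1)| ≤ M * ((t : ℝ) + 1) ^ q) :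
    Tendsto (fun t : ℕ => G t / (t : ℝ) ^ (q + 1)) atTop (nhds a) := by
  have hM : 0 ≤ M := by
    have := (abs_nonneg _).trans (h 0)
    simpa using this
  rw [tendsto_iff_dist_tendsto_zero]
  have hlim : Tendsto (fun t : ℕ => (M * 2 ^ q) / (t : ℝ)) atTop (nhds 0) :=
    tendsto_const_div_atTop_nhds_zero_nat _
  refine squeeze_zero' (Eventually.of_forall fun _ => dist_nonneg) ?_ hlim
  filter_upwards [eventually_ge_atTop 1] with t ht
  have ht1 : (1 : ℝ) ≤ t := by exact_mod_cast ht
  have ht0 : (0 : ℝ) < t := by linarith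
  have e : G t / (t : ℝ) ^ (q + 1) - a = (G t - a * (t : ℝ) ^ (q + 1)) / (t : ℝ) ^ (q + 1) := by
    field_simp
  rw [Real.dist_eq, e, abs_div, abs_of_pos (pow_pos ht0 _), div_le_div_iff₀ (by positivity) ht0]
  calc _ ≤ M * ((t : ℝ) + t) ^ q * t := by
        gcongr; exact (h t).trans (by gcongr)
    _ = _ := by rw [← two_mul, mul_pow]; ring

lemma finite_setOf_sum_natAbs_le {ι : Type*} [Fintype ι] (t : ℕ) :
    {x : ι → ℤ | ∑ i, (x i).natAbs ≤ t}.Finite := by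
  classical
  refine (Set.finite_Icc (fun _ : ι => -(t : ℤ)) (fun _ => (t : ℤ))).subset fun x hx => ?_
  have hi : ∀ i, (x i).natAbs ≤ t := fun i =>
    (Finset.single_le_sum (f := fun i => (x i).natAbs) (fun _ _ => Nat.zero_le _)
      (Finset.mem_univ i)).trans hx
  exact ⟨fun i => by have := hi i; simp only; omega, fun i => by have := hi i; simp only; omega⟩

lemma ncard_setOf_sum_natAbs_le {ι : Type*} [Fintype ι] (P : (ι → ℤ) → Prop) (t : ℕ) :
    {x : ι → ℤ | P x ∧ ∑ i, (x i).natAbs ≤ t}.ncard =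
      ∑ s ∈ Finset.range (t + 1), {x : ι → ℤ | P x ∧ ∑ i, (x i).natAbs = s}.ncard := by
  induction t with
  | zero => simp
  | succ t ih =>
    have hfin : {x : ι → ℤ | P x ∧ ∑ i, (x i).natAbs ≤ t}.Finite :=
      (finite_setOf_sum_natAbs_le t).subset fun x hx => hx.2
    have hfin' : {x : ι → ℤ | P x ∧ ∑ i, (x i).natAbs = t + 1}.Finite :=
      (finite_setOf_sum_natAbs_le (t + 1)).subset fun x hx => hx.2.le
    rw [Finset.sum_range_succ, ← ih, ← Set.ncard_union_eq ?_ hfin hfin']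
    · congr 1
      ext x
      simp only [Set.mem_ofPred_eq, Set.mem_union, ← and_or_left, Nat.le_succ_iff]
    · rw [Set.disjoint_left]
      rintro x ⟨_, h⟩ ⟨_, h'⟩
      omega

/-- The number of independent eigenfunctions associated with the lattice points of
`C ∩ B_{ℓ¹}(0,t)` is asymptotically `B(n−1,n+1)/((n−2)!·2^(n−1)) · t^(n−1)` times the
number of such lattice points:
`lim_{t→∞} F_{T∩C}(t) / (t^(n−1) · card(T ∩ C ∩ B_{ℓ¹}(0,t)))
  = B(n−1,n+1)/((n−2)!·2^(n−1))`. -/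
theorem stmt_11 (n : ℕ) (hn : 2 ≤ n)
    (T : AddSubgroup (Fin n → ℤ))
    (A : Matrix (Fin n) (Fin n) ℝ) (hA : IsUnit A.det)
    (hgen : ∀ x : Fin n → ℤ, x ∈ T ↔
      ∃ c : Fin n → ℤ, (fun i => (x i : ℝ)) = A.mulVec (fun j => (c j : ℝ)))
    (C : Set (Fin n → ℝ))
    (hCpos : C ⊆ {x | ∀ i, 0 ≤ x i})
    (hCcone : ∀ t : ℝ, 0 < t → ∀ x ∈ C, t • x ∈ C)
    (N : ℕ → ℕ)
    (hN : ∀ s : ℕ, N s = Set.ncard {x : Fin n → ℤ |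
      x ∈ T ∧ (fun i => (x i : ℝ)) ∈ C ∧ ∑ i, (x i).natAbs = s})
    (α : ℝ)
    (hα : α = (volume ((fun v => A⁻¹.mulVec v) '' C ∩
      {x : Fin n → ℝ | ∑ i, |x i| ≤ 1})).toReal)
    (hαpos : 0 < α)
    (M : ℝ) (hM : 0 < M)
    (hbound : ∀ t : ℕ, 1 ≤ t →
      |(∑ s ∈ Finset.range (t + 1), (N s : ℝ)) - α * (t : ℝ) ^ n| ≤ M * (t : ℝ) ^ (n - 1)) :
    Tendsto (fun t : ℕ =>
      (∑ s ∈ Finset.range (t + 1), ∑ r ∈ Finset.range (s / 2 + 1),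
        ((r + n - 2).choose (n - 2) : ℝ) * (N (s - 2 * r) : ℝ)) /
      ((t : ℝ) ^ (n - 1) *
        (Set.ncard {x : Fin n → ℤ |
          x ∈ T ∧ (fun i => (x i : ℝ)) ∈ C ∧ ∑ i, (x i).natAbs ≤ t} : ℝ)))
      atTop
      (nhds ((∫ x in (0:ℝ)..1, x ^ (n - 2) * (1 - x) ^ n) /
        ((n - 2).factorial * 2 ^ (n - 1)))) := by
  obtain ⟨m, rfl⟩ := Nat.exists_eq_add_of_le' hn
  have hcard : ∀ t : ℕ, (Set.ncard {x : Fin (m + 2) → ℤ |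
      x ∈ T ∧ (fun i => (x i : ℝ)) ∈ C ∧ ∑ i, (x i).natAbs ≤ t} : ℝ) =
        ∑ s ∈ Finset.range (t + 1), (N s : ℝ) := fun t => by
    have h := ncard_setOf_sum_natAbs_le
      (fun x : Fin (m + 2) → ℤ => x ∈ T ∧ (fun i => (x i : ℝ)) ∈ C) t
    simp only [and_assoc, ← hN] at h
    rw [h]
    push_cast
    rfl
  have hchoose : ∀ r : ℕ, (r + m).choose m = (m + 1).multichoose r := fun r => by
    rw [Nat.multichoose_eq, show m + 1 + r - 1 = r + m by omega, Nat.choose_symm_add]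
  have hS : ∀ t : ℕ, |∑ s ∈ Finset.range (t + 1), (N s : ℝ) - α * (t : ℝ) ^ (m + 1 + 1)| ≤
      (M + N 0) * ((t : ℝ) + 1) ^ (m + 1) := fun t => by
    rcases Nat.eq_zero_or_pos t with rfl | ht
    · simp [hM.le]
    · refine (hbound t ht).trans ?_
      have : (0 : ℝ) ≤ N 0 := (N 0).cast_nonneg
      rw [show m + 2 - 1 = m + 1 by omega]
      gcongr <;> linarith
  obtain ⟨M', hF⟩ := exists_abs_sum_harmonicConv_sub_le hS (m + 1)
  have hlim := (tendsto_div_pow_of_abs_sub_le hF).div (tendsto_div_pow_of_abs_sub_le hS) hαpos.ne'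
  simp only [hcard, hchoose, integral_pow_mul_one_sub_pow, Nat.add_sub_cancel,
    show ∀ r, r + (m + 2) - 2 = r + m by omega, show m + 2 - 1 = m + 1 by omega]
  refine (hlim.congr' ?_).trans_eq ?_
  · filter_upwards [eventually_ge_atTop 1] with t ht
    have ht0 : (0 : ℝ) < t := by exact_mod_cast ht
    simp only [Pi.div_apply, harmonicConv]
    rw [div_div_div_eq, show m + 1 + (m + 1) + 1 = (m + 1 + 1) + (m + 1) by ring,
      pow_add (t : ℝ) (m + 1 + 1) (m + 1), mul_assoc, mul_comm,
      mul_div_mul_left _ _ (pow_pos ht0 _).ne']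
  · have h : (m.factorial : ℝ) ≠ 0 := by positivity
    rw [show m + 1 + 1 + (m + 1) = m + (m + 2) + 1 by ring]
    congr 1
    field_simp
end
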